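/- (Reduction of the dual C² estimate to the boundary.) For every K > 0 there exist constants ε > 0 and C₂₀ > 0, depending only on n, Ω, Ω̃, h, h̃, θ, θ̃ and K, with the following property. Let f ∈ 𝒜 with ‖f‖_{C²(Ω̄ × closure(Ω̃))} ≤ K satisfy condition (OSC), sup |D_x f| ≤ ε and sup |D_{xp} f| ≤ ε. Let u be a smooth uniformly convex solution of the second boundary value problem with data (f, c) and let ũ be its Legendre transform. Then sup_{y ∈ Ω̃} ‖D²ũ(y)‖ ≤ 2·max_{y ∈ ∂Ω̃} ‖D²ũ(y)‖ + C₂₀, where ‖·‖ denotes the operator norm (largest eigenvalue) of the positive definite matrix D²ũ(y). -/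

import Mathlib

open Set MeasureTheory Matrix
open scoped Topology RealInnerProductSpace NNReal

noncomputable section

abbrev Euc (n : ℕ) := EuclideanSpace ℝ (Fin n)

variable {n : ℕ}

/-- Hessian matrix of `u` at `x`. -/
def Hess (u : Euc n → ℝ) (x : Euc n) : Matrix (Fin n) (Fin n) ℝ :=
  fun i j => iteratedFDeriv ℝ 2 u x ![EuclideanSpace.single i 1, EuclideanSpace.single j 1]

/-- `A ≤ B` in the sense of symmetric matrices. -/
def MatLE (A B : Matrix (Fin n) (Fin n) ℝ) : Prop := (B - A).PosSemidef

/-- The Minkowski mean-curvature operator `div (∇u / √(1 - |∇u|²))`. -/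
def MinkDiv (u : Euc n → ℝ) (x : Euc n) : ℝ :=
  ∑ i, fderiv ℝ (fun y => (Real.sqrt (1 - ‖gradient u y‖ ^ 2))⁻¹ * gradient u y i) x
    (EuclideanSpace.single i 1)

/-- The Euclidean mean-curvature operator `div (∇u / √(1 + |∇u|²))`. -/
def EucDiv (u : Euc n → ℝ) (x : Euc n) : ℝ :=
  ∑ i, fderiv ℝ (fun y => (Real.sqrt (1 + ‖gradient u y‖ ^ 2))⁻¹ * gradient u y i) x
    (EuclideanSpace.single i 1)

/-- `S(p) = (1/v)(Iₙ + p pᵀ / v²)`, `v = √(1-|p|²)`. -/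
def Smat (p : Euc n) : Matrix (Fin n) (Fin n) ℝ :=
  (Real.sqrt (1 - ‖p‖ ^ 2))⁻¹ •
    ((1 : Matrix (Fin n) (Fin n) ℝ) +
      (1 - ‖p‖ ^ 2)⁻¹ • Matrix.vecMulVec (fun i => p i) (fun j => p j))

/-- `B(p) = Iₙ + p pᵀ / (v (1 + v))`, `v = √(1-|p|²)`. -/
def Bmat (p : Euc n) : Matrix (Fin n) (Fin n) ℝ :=
  (1 : Matrix (Fin n) (Fin n) ℝ) +
    (Real.sqrt (1 - ‖p‖ ^ 2) * (1 + Real.sqrt (1 - ‖p‖ ^ 2)))⁻¹ •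
      Matrix.vecMulVec (fun i => p i) (fun j => p j)

/-- `A(x) = (1/v)·B(∇u)·D²u·B(∇u)`: its eigenvalues are the principal curvatures. -/
def Amat (u : Euc n → ℝ) (x : Euc n) : Matrix (Fin n) (Fin n) ℝ :=
  (Real.sqrt (1 - ‖gradient u x‖ ^ 2))⁻¹ •
    (Bmat (gradient u x) * Hess u x * Bmat (gradient u x))

/-- supremum of the quadratic form of `A` over the unit sphere (the operator
norm / largest eigenvalue for a positive semidefinite symmetric `A`). -/
def quadSup (A : Matrix (Fin n) (Fin n) ℝ) : ℝ :=
  ⨆ ξ : Metric.sphere (0 : Euc n) 1,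
    (fun i => (ξ : Euc n) i) ⬝ᵥ A.mulVec (fun i => (ξ : Euc n) i)

/-- The domains `Ω = {h̃ > 0}`, `Ω̃ = {h > 0}` are bounded uniformly convex domains
with smooth boundary, described by the defining functions `h̃` and `h`. -/
def DomainSetup (Ω Ωt : Set (Euc n)) (ht h : Euc n → ℝ) (θt θ : ℝ) : Prop :=
  IsOpen Ω ∧ IsOpen Ωt ∧ Bornology.IsBounded Ω ∧ Bornology.IsBounded Ωt ∧
  Ω.Nonempty ∧ Ωt.Nonempty ∧
  ContDiff ℝ (⊤ : ℕ∞) ht ∧ ContDiff ℝ (⊤ : ℕ∞) h ∧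
  Ω = {x | 0 < ht x} ∧ Ωt = {y | 0 < h y} ∧
  (∀ x ∈ frontier Ω, ‖gradient ht x‖ = 1) ∧
  (∀ y ∈ frontier Ωt, ‖gradient h y‖ = 1) ∧
  0 < θt ∧ 0 < θ ∧
  (∀ x : Euc n, MatLE (Hess ht x) ((-θt) • (1 : Matrix (Fin n) (Fin n) ℝ))) ∧
  (∀ y : Euc n, MatLE (Hess h y) ((-θ) • (1 : Matrix (Fin n) (Fin n) ℝ)))

/-- `f ∈ 𝒜`: `f` is `C²` on `Ω̄ × closure Ω̃` and concave in `x`. -/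
def InA (Ω Ωt : Set (Euc n)) (f : Euc n × Euc n → ℝ) : Prop :=
  ContDiffOn ℝ 2 f (closure Ω ×ˢ closure Ωt) ∧
  ∀ p ∈ closure Ωt, ConcaveOn ℝ (closure Ω) (fun x => f (x, p))

/-- Condition (OSC): `osc f ≤ (n/2)(|Ω̃|/|Ω|)^{1/n}`. -/
def OSCcond (Ω Ωt : Set (Euc n)) (f : Euc n × Euc n → ℝ) : Prop :=
  ∀ x ∈ closure Ω, ∀ y ∈ closure Ω, ∀ p ∈ closure Ωt, ∀ q ∈ closure Ωt,
    |f (x, p) - f (y, q)| ≤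
      ((n : ℝ) / 2) * ((volume Ωt).toReal / (volume Ω).toReal) ^ ((1 : ℝ) / n)

/-- `‖f‖_{C²(Ω̄ × closure Ω̃)} ≤ K`. -/
def C2Bound (Ω Ωt : Set (Euc n)) (f : Euc n × Euc n → ℝ) (K : ℝ) : Prop :=
  ContDiffOn ℝ 2 f (closure Ω ×ˢ closure Ωt) ∧
  ∀ z ∈ closure Ω ×ˢ closure Ωt,
    |f z| ≤ K ∧ ‖fderiv ℝ f z‖ ≤ K ∧ ‖iteratedFDeriv ℝ 2 f z‖ ≤ K

/-- `sup |D_x f| ≤ ε` on `Ω̄ × closure Ω̃`. -/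
def DxBound (Ω Ωt : Set (Euc n)) (f : Euc n × Euc n → ℝ) (ε : ℝ) : Prop :=
  ∀ x ∈ closure Ω, ∀ p ∈ closure Ωt, ‖fderiv ℝ (fun x' => f (x', p)) x‖ ≤ ε

/-- `sup |D_{xp} f| ≤ ε` on `Ω̄ × closure Ω̃`. -/
def DxpBound (Ω Ωt : Set (Euc n)) (f : Euc n × Euc n → ℝ) (ε : ℝ) : Prop :=
  ∀ x ∈ closure Ω, ∀ p ∈ closure Ωt,
    ‖fderiv ℝ (fun p' => fderiv ℝ (fun x' => f (x', p')) x) p‖ ≤ ε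

/-- A strictly convex solution of the second boundary value problem. -/
def IsStrictSol (Ω Ωt : Set (Euc n)) (f : Euc n × Euc n → ℝ) (c : ℝ) (u : Euc n → ℝ) : Prop :=
  ContDiffOn ℝ 2 u (closure Ω) ∧
  (∀ x ∈ closure Ω, (Hess u x).PosDef) ∧
  (∀ x ∈ closure Ω, ‖gradient u x‖ < 1) ∧
  (∀ x ∈ Ω, MinkDiv u x = f (x, gradient u x) + c) ∧
  gradient u '' Ω = Ωt

/-- A smooth uniformly convex solution of the second boundary value problem. -/
def IsSmoothSol (Ω Ωt : Set (Euc n)) (f : Euc n × Euc n → ℝ) (c : ℝ) (u : Euc n → ℝ) : Prop :=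
  ContDiffOn ℝ (⊤ : ℕ∞) u (closure Ω) ∧
  (∃ δ : ℝ, 0 < δ ∧ ∀ x ∈ closure Ω, MatLE (δ • (1 : Matrix (Fin n) (Fin n) ℝ)) (Hess u x)) ∧
  (∀ x ∈ closure Ω, ‖gradient u x‖ < 1) ∧
  (∀ x ∈ Ω, MinkDiv u x = f (x, gradient u x) + c) ∧
  gradient u '' Ω = Ωt

/-- A uniformly convex `C^{2}` solution of the second boundary value problem. -/
def IsUCSol (Ω Ωt : Set (Euc n)) (f : Euc n × Euc n → ℝ) (c : ℝ) (u : Euc n → ℝ) : Prop :=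
  ContDiffOn ℝ 2 u (closure Ω) ∧
  (∃ δ : ℝ, 0 < δ ∧ ∀ x ∈ closure Ω, MatLE (δ • (1 : Matrix (Fin n) (Fin n) ℝ)) (Hess u x)) ∧
  (∀ x ∈ closure Ω, ‖gradient u x‖ < 1) ∧
  (∀ x ∈ Ω, MinkDiv u x = f (x, gradient u x) + c) ∧
  gradient u '' Ω = Ωt

/-- A uniformly convex `C^{4,α}` solution of the second boundary value problem
for the Minkowski mean-curvature operator. -/
def IsC4Sol (Ω Ωt : Set (Euc n)) (f : Euc n × Euc n → ℝ) (c : ℝ) (u : Euc n → ℝ)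
    (α : ℝ) : Prop :=
  ContDiffOn ℝ 4 u (closure Ω) ∧
  (∃ C : ℝ≥0, HolderOnWith C (Real.toNNReal α) (fun x => iteratedFDeriv ℝ 4 u x) (closure Ω)) ∧
  (∃ δ : ℝ, 0 < δ ∧ ∀ x ∈ closure Ω, MatLE (δ • (1 : Matrix (Fin n) (Fin n) ℝ)) (Hess u x)) ∧
  (∀ x ∈ closure Ω, ‖gradient u x‖ < 1) ∧
  (∀ x ∈ Ω, MinkDiv u x = f (x, gradient u x) + c) ∧
  gradient u '' Ω = Ωt

/-- A uniformly convex `C^{4,α}` solution of the second boundary value problem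
for the Euclidean mean-curvature operator. -/
def IsC4SolE (Ω Ωt : Set (Euc n)) (f : Euc n × Euc n → ℝ) (c : ℝ) (u : Euc n → ℝ)
    (α : ℝ) : Prop :=
  ContDiffOn ℝ 4 u (closure Ω) ∧
  (∃ C : ℝ≥0, HolderOnWith C (Real.toNNReal α) (fun x => iteratedFDeriv ℝ 4 u x) (closure Ω)) ∧
  (∃ δ : ℝ, 0 < δ ∧ ∀ x ∈ closure Ω, MatLE (δ • (1 : Matrix (Fin n) (Fin n) ℝ)) (Hess u x)) ∧
  (∀ x ∈ Ω, EucDiv u x = f (x, gradient u x) + c) ∧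
  gradient u '' Ω = Ωt

/-- `ũ` is the Legendre transform of `u`. -/
def IsLegendre (Ω Ωt : Set (Euc n)) (u ut : Euc n → ℝ) : Prop :=
  ContDiffOn ℝ (⊤ : ℕ∞) ut (closure Ωt) ∧
  (∀ x ∈ closure Ω, ut (gradient u x) = ⟪x, gradient u x⟫ - u x) ∧
  (∀ x ∈ closure Ω, gradient ut (gradient u x) = x) ∧
  (∀ x ∈ closure Ω, Hess ut (gradient u x) = (Hess u x)⁻¹)

section Calculus

open Filter

variable {E F G : Type*} [NormedAddCommGroup E] [NormedSpace ℝ E]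
  [NormedAddCommGroup F] [NormedSpace ℝ F] [NormedAddCommGroup G] [NormedSpace ℝ G]

lemma two_le_smooth : (2 : WithTop ℕ∞) ≤ ((⊤ : ℕ∞) : WithTop ℕ∞) := by
  exact WithTop.coe_le_coe.mpr (le_top : (2 : ℕ∞) ≤ ⊤)

/-- Iterated directional derivatives are the values of the second derivative. -/
lemma fderiv_fderiv_apply {g : E → F} {y : E} (hg : ContDiffAt ℝ 2 g y) (a b : E) :
    fderiv ℝ (fun z => fderiv ℝ g z b) y a = fderiv ℝ (fderiv ℝ g) y a b := by
  have hd : DifferentiableAt ℝ (fderiv ℝ g) y :=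
    (hg.fderiv_right (m := 1) (by norm_num)).differentiableAt (by norm_num)
  have h1 := (hd.hasFDerivAt.clm_apply (hasFDerivAt_const b y)).fderiv
  rw [h1]
  simp

/-- The second derivative of a real function along a line. -/
lemma hasDerivAt_line {g : E → ℝ} {y : E} (hg : ContDiffAt ℝ 2 g y) (a : E) :
    (deriv (fun t : ℝ => g (y + t • a)) =ᶠ[𝓝 0] fun t => fderiv ℝ g (y + t • a) a) ∧
      deriv (deriv (fun t : ℝ => g (y + t • a))) 0 = fderiv ℝ (fderiv ℝ g) y a a := by
  have hline : ∀ t : ℝ, HasDerivAt (fun t : ℝ => y + t • a) a t := fun t => by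
    simpa using ((hasDerivAt_id t).smul_const a).const_add y
  have hcont : Tendsto (fun t : ℝ => y + t • a) (𝓝 0) (𝓝 y) := by
    simpa using (hline 0).continuousAt.tendsto
  have h1 : deriv (fun t : ℝ => g (y + t • a)) =ᶠ[𝓝 0] fun t => fderiv ℝ g (y + t • a) a := by
    filter_upwards [hcont.eventually (hg.eventually (by norm_num))] with t ht
    have := (ht.differentiableAt (by norm_num)).hasFDerivAt.comp_hasDerivAt t (hline t)
    exact this.deriv
  refine ⟨h1, ?_⟩
  rw [h1.deriv_eq]
  have hd : DifferentiableAt ℝ (fderiv ℝ g) (y + (0 : ℝ) • a) := by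
    simpa using (hg.fderiv_right (m := 1) (by norm_num)).differentiableAt (by norm_num)
  have h2 : HasDerivAt (fun t : ℝ => fderiv ℝ g (y + t • a))
      (fderiv ℝ (fderiv ℝ g) (y + (0 : ℝ) • a) a) 0 :=
    HasFDerivAt.comp_hasDerivAt (0 : ℝ) hd.hasFDerivAt (hline 0)
  have h3 := (h2.clm_apply (hasDerivAt_const (0 : ℝ) a)).deriv
  rw [h3]
  simp

/-- Second-order necessary condition at a local minimum. -/
lemma IsLocalMin.fderiv_fderiv_nonneg {g : E → ℝ} {y : E} (hg : ContDiffAt ℝ 2 g y)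
    (hm : IsLocalMin g y) (a : E) : 0 ≤ fderiv ℝ (fderiv ℝ g) y a a := by
  by_contra! hneg
  obtain ⟨h1, h2⟩ := hasDerivAt_line hg a
  have hcont : Tendsto (fun t : ℝ => y + t • a) (𝓝 0) (𝓝 y) := by
    have : Continuous (fun t : ℝ => y + t • a) := by fun_prop
    simpa using this.tendsto 0
  have hmin : IsLocalMin (fun t : ℝ => g (y + t • a)) 0 := by
    have := hcont.eventually hm
    simpa [IsLocalMin, IsMinFilter] using this
  have hmax : IsLocalMax (fun t : ℝ => g (y + t • a)) 0 := by
    refine isLocalMax_of_deriv_deriv_neg (by rwa [h2]) hmin.deriv_eq_zero ?_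
    have h0 : ContinuousAt g (y + (0 : ℝ) • a) := by simpa using hg.continuousAt
    exact ContinuousAt.comp (f := fun t : ℝ => y + t • a) h0 (by fun_prop)
  have hconst : (fun t : ℝ => g (y + t • a)) =ᶠ[𝓝 0] fun _ => g (y + (0 : ℝ) • a) := by
    filter_upwards [hmin, hmax] with t h h'
    exact le_antisymm h' h
  have h3 : deriv (deriv (fun t : ℝ => g (y + t • a))) 0 = 0 := by
    rw [hconst.deriv.deriv_eq]
    simp
  linarith

/-- Second-order necessary condition at a local maximum. -/
lemma IsLocalMax.fderiv_fderiv_nonpos {g : E → ℝ} {y : E} (hg : ContDiffAt ℝ 2 g y)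
    (hm : IsLocalMax g y) (a : E) : fderiv ℝ (fderiv ℝ g) y a a ≤ 0 := by
  have h := IsLocalMin.fderiv_fderiv_nonneg hg.neg hm.neg a
  have h1 : fderiv ℝ (fun z => - g z) = fun z => - fderiv ℝ g z := by
    ext1 z; exact fderiv_fun_neg
  rw [h1, fderiv_fun_neg] at h
  simpa using h

/-- Linearity of the second derivative. -/
lemma fderiv_fderiv_add {g k : E → F} {y : E} (hg : ContDiffAt ℝ 2 g y)
    (hk : ContDiffAt ℝ 2 k y) :
    fderiv ℝ (fderiv ℝ fun z => g z + k z) y =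
      fderiv ℝ (fderiv ℝ g) y + fderiv ℝ (fderiv ℝ k) y := by
  have h1 : fderiv ℝ (fun z => g z + k z) =ᶠ[𝓝 y] fun z => fderiv ℝ g z + fderiv ℝ k z := by
    filter_upwards [hg.eventually (by norm_num), hk.eventually (by norm_num)] with z h h'
    exact fderiv_fun_add (h.differentiableAt (by norm_num)) (h'.differentiableAt (by norm_num))
  rw [h1.fderiv_eq]
  exact fderiv_fun_add ((hg.fderiv_right (m := 1) (by norm_num)).differentiableAt (by norm_num))
    ((hk.fderiv_right (m := 1) (by norm_num)).differentiableAt (by norm_num))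

/-- The second derivative of a composition with a continuous linear map. -/
lemma fderiv_fderiv_clm_comp (L : F →L[ℝ] G) {g : E → F} {y : E} (hg : ContDiffAt ℝ 2 g y)
    (a b : E) : fderiv ℝ (fderiv ℝ fun z => L (g z)) y a b =
      L (fderiv ℝ (fderiv ℝ g) y a b) := by
  have hL : ContDiffAt ℝ 2 (fun z => L (g z)) y := L.contDiff.contDiffAt.comp y hg
  rw [← fderiv_fderiv_apply hL, ← fderiv_fderiv_apply hg]
  have h1 : (fun z => fderiv ℝ (fun z => L (g z)) z b) =ᶠ[𝓝 y] fun z => L (fderiv ℝ g z b) := by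
    filter_upwards [hg.eventually (by norm_num)] with z h
    have := (L.hasFDerivAt.comp z (h.differentiableAt (by norm_num)).hasFDerivAt).fderiv
    change fderiv ℝ (L ∘ g) z b = _
    rw [this]; rfl
  rw [h1.fderiv_eq]
  have hd : DifferentiableAt ℝ (fun z => fderiv ℝ g z b) y :=
    ((hg.fderiv_right (m := 1) (by norm_num)).clm_apply contDiffAt_const).differentiableAt
      (by norm_num)
  have := (L.hasFDerivAt.comp y hd.hasFDerivAt).fderiv
  change fderiv ℝ (L ∘ fun z => fderiv ℝ g z b) y a = _
  rw [this]; rfl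

/-- Second-order chain rule. -/
lemma fderiv_fderiv_comp {f : F → G} {g : E → F} {y : E} (hf : ContDiffAt ℝ 2 f (g y))
    (hg : ContDiffAt ℝ 2 g y) (a : E) :
    fderiv ℝ (fderiv ℝ fun z => f (g z)) y a a =
      fderiv ℝ (fderiv ℝ f) (g y) (fderiv ℝ g y a) (fderiv ℝ g y a) +
        fderiv ℝ f (g y) (fderiv ℝ (fderiv ℝ g) y a a) := by
  have hfg : ContDiffAt ℝ 2 (fun z => f (g z)) y := hf.comp y hg
  rw [← fderiv_fderiv_apply hfg, ← fderiv_fderiv_apply hg]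
  have h1 : (fun z => fderiv ℝ (fun z => f (g z)) z a) =ᶠ[𝓝 y]
      fun z => fderiv ℝ f (g z) (fderiv ℝ g z a) := by
    filter_upwards [hg.eventually (by norm_num),
      hg.continuousAt.eventually (hf.eventually (by norm_num))] with z h h'
    have := ((h'.differentiableAt (by norm_num)).hasFDerivAt.comp z
      (h.differentiableAt (by norm_num)).hasFDerivAt).fderiv
    change fderiv ℝ (f ∘ g) z a = _
    rw [this]; rfl
  rw [h1.fderiv_eq]
  have hd : DifferentiableAt ℝ (fun z => fderiv ℝ g z a) y :=
    ((hg.fderiv_right (m := 1) (by norm_num)).clm_apply contDiffAt_const).differentiableAt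
      (by norm_num)
  have hf' : DifferentiableAt ℝ (fderiv ℝ f) (g y) :=
    (hf.fderiv_right (m := 1) (by norm_num)).differentiableAt (by norm_num)
  have h2 := ((hf'.hasFDerivAt.comp y (hg.differentiableAt (by norm_num)).hasFDerivAt).clm_apply
    hd.hasFDerivAt).fderiv
  simp only [Function.comp_apply] at h2
  rw [h2]
  simp [add_comm]

/-- Directional derivatives of a smooth function on an open set are smooth. -/
lemma contDiffOn_fderiv_apply {g : E → F} {U : Set E} (hU : IsOpen U)
    (hg : ContDiffOn ℝ (⊤ : ℕ∞) g U) (a : E) :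
    ContDiffOn ℝ (⊤ : ℕ∞) (fun z => fderiv ℝ g z a) U :=
  (hg.fderiv_of_isOpen hU (by norm_num)).clm_apply contDiffOn_const

/-- Directional derivatives commute. -/
lemma fderiv_apply_comm {g : E → F} {y : E} (hg : ContDiffAt ℝ 2 g y) (a b : E) :
    fderiv ℝ (fun z => fderiv ℝ g z b) y a = fderiv ℝ (fun z => fderiv ℝ g z a) y b := by
  rw [fderiv_fderiv_apply hg, fderiv_fderiv_apply hg]
  exact (hg.isSymmSndFDerivAt (by simp)).eq a b

lemma fderiv_apply_congr {g k : E → F} {U : Set E} (hU : IsOpen U) (hgk : EqOn g k U) (a : E)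
    {z : E} (hz : z ∈ U) : fderiv ℝ g z a = fderiv ℝ k z a := by
  have : g =ᶠ[𝓝 z] k := hgk.eventuallyEq_of_mem (hU.mem_nhds hz)
  rw [this.fderiv_eq]

/-- Symmetry of third derivatives. -/
lemma fderiv_fderiv_apply_comm {g : E → F} {U : Set E} (hU : IsOpen U)
    (hg : ContDiffOn ℝ (⊤ : ℕ∞) g U) {y : E} (hy : y ∈ U) (a b : E) :
    fderiv ℝ (fderiv ℝ fun z => fderiv ℝ g z b) y a a =
      fderiv ℝ (fun z => fderiv ℝ (fderiv ℝ g) z a a) y b := by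
  have h2 : ∀ {k : E → F}, ContDiffOn ℝ (⊤ : ℕ∞) k U → ∀ z ∈ U, ContDiffAt ℝ 2 k z :=
    fun hk z hz => (hk.contDiffAt (hU.mem_nhds hz)).of_le two_le_smooth
  have hb := contDiffOn_fderiv_apply hU hg b
  have ha := contDiffOn_fderiv_apply hU hg a
  rw [← fderiv_fderiv_apply (h2 hb y hy)]
  have e1 : EqOn (fun z => fderiv ℝ (fun w => fderiv ℝ g w b) z a)
      (fun z => fderiv ℝ (fun w => fderiv ℝ g w a) z b) U :=
    fun z hz => fderiv_apply_comm (h2 hg z hz) a b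
  have e2 : EqOn (fun z => fderiv ℝ (fderiv ℝ g) z a a)
      (fun z => fderiv ℝ (fun w => fderiv ℝ g w a) z a) U :=
    fun z hz => (fderiv_fderiv_apply (h2 hg z hz) a a).symm
  rw [fderiv_apply_congr hU e1 a hy, fderiv_apply_congr hU e2 b hy]
  exact fderiv_apply_comm (h2 ha y hy) a b

/-- Symmetry of fourth derivatives. -/
lemma fderiv_fderiv_fderiv_comm {g : E → F} {U : Set E} (hU : IsOpen U)
    (hg : ContDiffOn ℝ (⊤ : ℕ∞) g U) {y : E} (hy : y ∈ U) (a b : E) :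
    fderiv ℝ (fderiv ℝ fun z => fderiv ℝ (fderiv ℝ g) z b b) y a a =
      fderiv ℝ (fderiv ℝ fun z => fderiv ℝ (fderiv ℝ g) z a a) y b b := by
  have h2 : ∀ {k : E → F}, ContDiffOn ℝ (⊤ : ℕ∞) k U → ∀ z ∈ U, ContDiffAt ℝ 2 k z :=
    fun hk z hz => (hk.contDiffAt (hU.mem_nhds hz)).of_le two_le_smooth
  have hb := contDiffOn_fderiv_apply hU hg b
  have ebb : ∀ c, EqOn (fun z => fderiv ℝ (fderiv ℝ g) z c c)
      (fun z => fderiv ℝ (fun w => fderiv ℝ g w c) z c) U :=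
    fun c z hz => (fderiv_fderiv_apply (h2 hg z hz) c c).symm
  have hcc : ∀ c, ContDiffOn ℝ (⊤ : ℕ∞) (fun z => fderiv ℝ (fderiv ℝ g) z c c) U := fun c =>
    (contDiffOn_fderiv_apply hU (contDiffOn_fderiv_apply hU hg c) c).congr (ebb c)
  rw [← fderiv_fderiv_apply (h2 (hcc a) y hy)]
  have e1 : EqOn (fun z => fderiv ℝ (fun z => fderiv ℝ (fderiv ℝ g) z a a) z b)
      (fun z => fderiv ℝ (fderiv ℝ fun z => fderiv ℝ g z b) z a a) U :=
    fun z hz => (fderiv_fderiv_apply_comm hU hg hz a b).symm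
  rw [fderiv_apply_congr hU e1 b hy, ← fderiv_fderiv_apply_comm hU hb hy a b]
  have e3 := (ebb b).eventuallyEq_of_mem (hU.mem_nhds hy)
  rw [e3.fderiv.fderiv_eq]

end Calculus

/-- The Hessian matrix represents the second Fréchet derivative. -/
lemma dotProduct_hess_mulVec (u : Euc n → ℝ) (x a b : Euc n) :
    (fun i => a i) ⬝ᵥ (Hess u x *ᵥ fun j => b j) = fderiv ℝ (fderiv ℝ u) x a b := by
  have key : ∀ c : Euc n, c = ∑ i, c i • (EuclideanSpace.single i (1 : ℝ) : Euc n) := fun c => by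
    simpa using ((EuclideanSpace.basisFun (Fin n) ℝ).sum_repr c).symm
  have h1 : fderiv ℝ (fderiv ℝ u) x a b = ∑ i, a i * ∑ j, b j *
      fderiv ℝ (fderiv ℝ u) x (EuclideanSpace.single i 1) (EuclideanSpace.single j 1) := by
    conv_lhs => rw [key a, key b]
    simp only [map_sum, map_smul, _root_.sum_apply, _root_.smul_apply, smul_eq_mul,
      Finset.mul_sum]
    rw [Finset.sum_comm]
    exact Finset.sum_congr rfl fun i _ => Finset.sum_congr rfl fun j _ => by ring
  rw [h1]
  simp [dotProduct, Matrix.mulVec, Hess, iteratedFDeriv_two_apply, mul_comm]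

lemma hess_apply (u : Euc n → ℝ) (x : Euc n) (i j : Fin n) :
    Hess u x i j = fderiv ℝ (fderiv ℝ u) x (EuclideanSpace.single i 1)
      (EuclideanSpace.single j 1) := by
  simp [Hess, iteratedFDeriv_two_apply]

/-- An upper bound of the Hessian in the order of symmetric matrices bounds its quadratic form. -/
lemma MatLE.fderiv_fderiv_le {u : Euc n → ℝ} {x : Euc n} {δ : ℝ}
    (h : MatLE (Hess u x) (δ • (1 : Matrix (Fin n) (Fin n) ℝ))) (a : Euc n) :
    fderiv ℝ (fderiv ℝ u) x a a ≤ δ * ‖a‖ ^ 2 := by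
  have h1 := h.dotProduct_mulVec_nonneg (fun i => a i)
  rw [Matrix.sub_mulVec, dotProduct_sub] at h1
  have h2 : star (fun i => a i) = fun i => a i := by ext; simp
  rw [h2, dotProduct_hess_mulVec, Matrix.smul_mulVec, Matrix.one_mulVec, dotProduct_smul] at h1
  have h3 : (fun i => a i) ⬝ᵥ (fun i => a i) = ‖a‖ ^ 2 := by
    rw [EuclideanSpace.real_norm_sq_eq]
    simp [dotProduct, sq]
  rw [h3, smul_eq_mul] at h1
  linarith

/-- A positivity set of a function with nonpositive second derivative is convex. -/
lemma convex_pos_of_fderiv_fderiv_nonpos {E : Type*} [NormedAddCommGroup E] [NormedSpace ℝ E]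
    {h : E → ℝ} (hh : ContDiff ℝ 2 h)
    (hneg : ∀ y a, fderiv ℝ (fderiv ℝ h) y a a ≤ 0) : Convex ℝ {y | 0 < h y} := by
  rw [convex_iff_segment_subset]
  intro x hx y hy z hz
  rw [segment_eq_image'] at hz
  obtain ⟨t, ⟨ht0, ht1⟩, rfl⟩ := hz
  have hline : ContDiff ℝ 2 (fun s : ℝ => h (x + s • (y - x))) :=
    hh.comp (contDiff_const.add (contDiff_id.smul contDiff_const))
  have hd2 : ContDiff ℝ 1 (deriv fun s : ℝ => h (x + s • (y - x))) :=
    ((contDiff_succ_iff_deriv (n := 1)).1 (by rw [one_add_one_eq_two]; exact hline)).2.2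
  have hderiv : ∀ s : ℝ, deriv^[2] (fun s : ℝ => h (x + s • (y - x))) s ≤ 0 := by
    intro s
    have h1 := (hasDerivAt_line (hh.contDiffAt (x := x + s • (y - x))) (y - x)).2
    have h2 : (fun r : ℝ => h (x + s • (y - x) + r • (y - x))) =
        fun r : ℝ => (fun q : ℝ => h (x + q • (y - x))) (s + r) := by
      ext r; simp only [add_smul, add_assoc]
    rw [h2] at h1
    have h3 : ∀ (ψ : ℝ → ℝ) (r : ℝ), deriv (deriv fun r => ψ (s + r)) r =
        deriv (deriv ψ) (s + r) := fun ψ r => by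
      have h4 : (deriv fun r => ψ (s + r)) = fun r => deriv ψ (s + r) := by
        ext q; exact deriv_comp_const_add ψ s q
      rw [h4, deriv_comp_const_add]
    have h5 := (h3 (fun q : ℝ => h (x + q • (y - x))) 0).symm.trans h1
    rw [add_zero] at h5
    exact h5.trans_le (hneg _ _)
  have hconc := concaveOn_univ_of_deriv2_nonpos (hline.differentiable (by norm_num))
    (hd2.differentiable (by norm_num)) hderiv
  have := hconc.2 (mem_univ 0) (mem_univ 1) (sub_nonneg.2 ht1) ht0 (by ring)
  simp only [smul_eq_mul, mul_zero, mul_one, zero_add, zero_smul, add_zero, one_smul,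
    add_sub_cancel] at this
  simp only [mem_ofPred_eq] at hx hy ⊢
  rcases eq_or_lt_of_le ht0 with h0 | h0
  · subst h0; simpa using hx
  · nlinarith [mul_pos h0 hy, mul_nonneg (sub_nonneg.2 ht1) hx.le]

/-- If a function is smooth up to the boundary of an open convex set and its second derivative
does not vanish on the closure, then its second derivative is continuous on the closure. -/
lemma continuousOn_fderiv_fderiv_closure {E : Type*} [NormedAddCommGroup E] [NormedSpace ℝ E]
    {g : E → ℝ} {U : Set E} (hU : IsOpen U) (hne : U.Nonempty) (hconv : Convex ℝ U)
    (hg : ContDiffOn ℝ (⊤ : ℕ∞) g (closure U))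
    (h0 : ∀ y ∈ closure U, fderiv ℝ (fderiv ℝ g) y ≠ 0) :
    ContinuousOn (fderiv ℝ (fderiv ℝ g)) (closure U) := by
  have hsub : U ⊆ interior (closure U) := interior_maximal subset_closure hU
  have huniq : UniqueDiffOn ℝ (closure U) := uniqueDiffOn_convex hconv.closure (hne.mono hsub)
  have hdiff : ∀ y ∈ closure U, DifferentiableAt ℝ (fderiv ℝ g) y := fun y hy => by
    by_contra hnd
    exact h0 y hy (fderiv_zero_of_not_differentiableAt hnd)
  have hwithin : ContDiffOn ℝ 1 (fderivWithin ℝ g (closure U)) (closure U) :=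
    (hg.of_le two_le_smooth).fderivWithin huniq (by norm_num)
  have heqU : ∀ y ∈ U, fderiv ℝ g y = fderivWithin ℝ g (closure U) y := fun y hy =>
    (fderivWithin_of_mem_nhds (Filter.mem_of_superset (hU.mem_nhds hy) subset_closure)).symm
  have heq : EqOn (fderiv ℝ g) (fderivWithin ℝ g (closure U)) (closure U) := by
    intro y hy
    have : (𝓝[U] y).NeBot := mem_closure_iff_nhdsWithin_neBot.1 hy
    have t1 : Filter.Tendsto (fderiv ℝ g) (𝓝[U] y) (𝓝 (fderiv ℝ g y)) :=
      (hdiff y hy).continuousAt.continuousWithinAt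
    have t2 : Filter.Tendsto (fderivWithin ℝ g (closure U)) (𝓝[U] y)
        (𝓝 (fderivWithin ℝ g (closure U) y)) :=
      (hwithin.continuousOn y hy).mono subset_closure
    refine tendsto_nhds_unique (t1.congr' ?_) t2
    filter_upwards [self_mem_nhdsWithin] with z hz using heqU z hz
  have heq2 : EqOn (fderiv ℝ (fderiv ℝ g))
      (fderivWithin ℝ (fderivWithin ℝ g (closure U)) (closure U)) (closure U) := by
    intro y hy
    rw [← (hdiff y hy).fderivWithin (huniq y hy)]
    exact fderivWithin_congr heq (heq hy)
  exact (hwithin.continuousOn_fderivWithin huniq le_rfl).congr heq2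

/-- The Riesz isomorphism as a continuous linear map. -/
def rieszCLM (n : ℕ) : (Euc n →L[ℝ] ℝ) →L[ℝ] Euc n :=
  LinearMap.toContinuousLinearMap
    { toFun := (InnerProductSpace.toDual ℝ (Euc n)).symm
      map_add' := fun a b => map_add _ a b
      map_smul' := fun c a => by simp }

/-- The derivative of the gradient is represented by the second derivative. -/
lemma hasFDerivAt_gradient {u : Euc n → ℝ} {x : Euc n}
    (hu : DifferentiableAt ℝ (fderiv ℝ u) x) :
    HasFDerivAt (gradient u) ((rieszCLM n).comp (fderiv ℝ (fderiv ℝ u) x)) x :=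
  (rieszCLM n).hasFDerivAt.comp x hu.hasFDerivAt

lemma inner_fderiv_gradient {u : Euc n → ℝ} {x : Euc n}
    (hu : DifferentiableAt ℝ (fderiv ℝ u) x) (a b : Euc n) :
    ⟪fderiv ℝ (gradient u) x a, b⟫ = fderiv ℝ (fderiv ℝ u) x a b := by
  rw [(hasFDerivAt_gradient hu).fderiv]
  exact InnerProductSpace.toDual_symm_apply

lemma contDiffOn_gradient {u : Euc n → ℝ} {U : Set (Euc n)} (hU : IsOpen U)
    (hu : ContDiffOn ℝ (⊤ : ℕ∞) u U) : ContDiffOn ℝ (⊤ : ℕ∞) (gradient u) U :=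
  (rieszCLM n).contDiff.comp_contDiffOn (hu.fderiv_of_isOpen hU (by norm_num))

/-- The vectors `r` with `∑ r rᵀ = S(p)`. -/
def frame (k : Option (Fin n)) (p : Euc n) : Euc n :=
  k.elim ((√√(1 - ‖p‖ ^ 2))⁻¹ ^ 3 • p)
    (fun i => (√√(1 - ‖p‖ ^ 2))⁻¹ • EuclideanSpace.single i 1)

lemma contDiffOn_frame (k : Option (Fin n)) :
    ContDiffOn ℝ (⊤ : ℕ∞) (frame k) (Metric.ball (0 : Euc n) 1) := by
  intro p hp
  refine ContDiffAt.contDiffWithinAt ?_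
  have hp' : 0 < 1 - ‖p‖ ^ 2 := by
    have : ‖p‖ < 1 := by simpa using hp
    nlinarith [norm_nonneg p]
  have h0 : ContDiffAt ℝ (⊤ : ℕ∞) (fun p : Euc n => (√√(1 - ‖p‖ ^ 2))⁻¹) p := by
    refine ContDiffAt.inv (ContDiffAt.sqrt (ContDiffAt.sqrt ?_ hp'.ne') ?_) ?_
    · exact contDiffAt_const.sub (contDiff_norm_sq ℝ).contDiffAt
    · exact (Real.sqrt_pos.2 hp').ne'
    · exact (Real.sqrt_pos.2 (Real.sqrt_pos.2 hp')).ne'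
  cases k with
  | none => exact (h0.pow 3).smul contDiffAt_id
  | some i => exact h0.smul contDiffAt_const

/-- The Minkowski mean-curvature operator in nondivergence form. -/
lemma minkDiv_eq_sum {u : Euc n → ℝ} {x : Euc n} (hu : DifferentiableAt ℝ (fderiv ℝ u) x)
    (hx : ‖gradient u x‖ < 1) :
    MinkDiv u x = (√(1 - ‖gradient u x‖ ^ 2))⁻¹ * ∑ i, fderiv ℝ (fderiv ℝ u) x
        (EuclideanSpace.single i 1) (EuclideanSpace.single i 1) +
      (√(1 - ‖gradient u x‖ ^ 2))⁻¹ ^ 3 *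
        fderiv ℝ (fderiv ℝ u) x (gradient u x) (gradient u x) := by
  set g := gradient u with hgdef
  set L := fderiv ℝ (fderiv ℝ u) x with hL
  have hg : HasFDerivAt g (fderiv ℝ g x) x :=
    (hasFDerivAt_gradient hu).differentiableAt.hasFDerivAt
  have hpos : 0 < 1 - ‖g x‖ ^ 2 := by nlinarith [norm_nonneg (g x)]
  have hv : 0 < √(1 - ‖g x‖ ^ 2) := Real.sqrt_pos.2 hpos
  have hs := ((hg.norm_sq).const_sub 1).sqrt hpos.ne'
  have hinv := (hasDerivAt_inv hv.ne').comp_hasFDerivAt x hs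
  have hterm : ∀ i : Fin n, fderiv ℝ (fun y => (√(1 - ‖g y‖ ^ 2))⁻¹ * g y i) x
      (EuclideanSpace.single i 1) =
      (√(1 - ‖g x‖ ^ 2))⁻¹ * L (EuclideanSpace.single i 1) (EuclideanSpace.single i 1) +
      (√(1 - ‖g x‖ ^ 2))⁻¹ ^ 3 * (g x i * L (EuclideanSpace.single i 1) (g x)) := by
    intro i
    have hgi : HasFDerivAt (fun y => g y i)
        ((EuclideanSpace.proj i : Euc n →L[ℝ] ℝ).comp (fderiv ℝ g x)) x :=
      ((EuclideanSpace.proj i : Euc n →L[ℝ] ℝ).hasFDerivAt).comp x hg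
    have h1 : fderiv ℝ (fun y => (√(1 - ‖g y‖ ^ 2))⁻¹ * g y i) x = _ := (hinv.mul hgi).fderiv
    have h2 : (fderiv ℝ g x (EuclideanSpace.single i 1)) i =
        L (EuclideanSpace.single i 1) (EuclideanSpace.single i 1) := by
      rw [hL, ← inner_fderiv_gradient hu]
      simp [hgdef, EuclideanSpace.inner_single_right]
    have h3 : ⟪g x, fderiv ℝ g x (EuclideanSpace.single i 1)⟫ =
        L (EuclideanSpace.single i 1) (g x) := by
      rw [hL, ← inner_fderiv_gradient hu, real_inner_comm]
    rw [h1]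
    simp [h2, h3]
    field_simp
  have hsum : L (g x) (g x) = ∑ i, g x i * L (EuclideanSpace.single i 1) (g x) := by
    have key : g x = ∑ i, g x i • (EuclideanSpace.single i (1 : ℝ) : Euc n) := by
      simpa using ((EuclideanSpace.basisFun (Fin n) ℝ).sum_repr (g x)).symm
    have : L (g x) = ∑ i, g x i • L (EuclideanSpace.single i (1 : ℝ)) := by
      conv_lhs => rw [key]
      simp only [map_sum, map_smul]
    conv_lhs => rw [this]
    simp only [_root_.sum_apply, _root_.smul_apply, smul_eq_mul]
  unfold MinkDiv
  rw [Finset.sum_congr rfl fun i _ => hterm i, Finset.sum_add_distrib, ← Finset.mul_sum,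
    ← Finset.mul_sum, hsum]

lemma minkDiv_eq_sum_frame {u : Euc n → ℝ} {x : Euc n}
    (hu : DifferentiableAt ℝ (fderiv ℝ u) x) (hx : ‖gradient u x‖ < 1) :
    MinkDiv u x = ∑ k, fderiv ℝ (fderiv ℝ u) x (frame k (gradient u x))
      (frame k (gradient u x)) := by
  have h1 : (√√(1 - ‖gradient u x‖ ^ 2))⁻¹ ^ 2 = (√(1 - ‖gradient u x‖ ^ 2))⁻¹ := by
    rw [inv_pow, Real.sq_sqrt (Real.sqrt_nonneg _)]
  rw [minkDiv_eq_sum hu hx, Fintype.sum_option, ← h1, Finset.mul_sum, add_comm]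
  congr 1
  · simp only [frame, Option.elim_none, map_smul, _root_.smul_apply, smul_eq_mul]
    ring
  · refine Finset.sum_congr rfl fun i _ => ?_
    simp only [frame, Option.elim_some, map_smul, _root_.smul_apply, smul_eq_mul]
    ring

lemma trace_hess_le_minkDiv {u : Euc n → ℝ} {x : Euc n}
    (hu : DifferentiableAt ℝ (fderiv ℝ u) x) (hx : ‖gradient u x‖ < 1)
    (hpos : ∀ a, 0 ≤ fderiv ℝ (fderiv ℝ u) x a a) : (Hess u x).trace ≤ MinkDiv u x := by
  have h1 : (Hess u x).trace = ∑ i, fderiv ℝ (fderiv ℝ u) x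
        (EuclideanSpace.single i 1) (EuclideanSpace.single i 1) := by
    simp [Matrix.trace, hess_apply]
  have hp : 0 < 1 - ‖gradient u x‖ ^ 2 := by nlinarith [norm_nonneg (gradient u x)]
  have hv : 1 ≤ (√(1 - ‖gradient u x‖ ^ 2))⁻¹ := by
    rw [one_le_inv₀ (Real.sqrt_pos.2 hp)]
    exact Real.sqrt_le_one.2 (by nlinarith [norm_nonneg (gradient u x)])
  rw [minkDiv_eq_sum hu hx, h1]
  have h2 : 0 ≤ ∑ i, fderiv ℝ (fderiv ℝ u) x
        (EuclideanSpace.single i 1) (EuclideanSpace.single i 1) :=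
    Finset.sum_nonneg fun i _ => hpos _
  have h3 := mul_nonneg (pow_nonneg (zero_le_one.trans hv) 3) (hpos (gradient u x))
  nlinarith

/-- The arithmetic–geometric mean inequality for positive semidefinite matrices. -/
lemma Matrix.PosSemidef.det_le_trace_div_pow {A : Matrix (Fin n) (Fin n) ℝ} (hA : A.PosSemidef)
    (hn : n ≠ 0) : A.det ≤ (A.trace / n) ^ n := by
  have hn' : (n : ℝ) ≠ 0 := by exact_mod_cast hn
  have hz : ∀ i ∈ Finset.univ, 0 ≤ hA.1.eigenvalues i := fun i _ => hA.eigenvalues_nonneg i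
  have h := Real.geom_mean_le_arith_mean_weighted Finset.univ (fun _ : Fin n => (1 / n : ℝ))
    hA.1.eigenvalues (fun _ _ => by positivity) (by simp [hn']) hz
  have h2 := pow_le_pow_left₀ (Finset.prod_nonneg fun i hi => Real.rpow_nonneg (hz i hi) _) h n
  rw [← Finset.prod_pow] at h2
  have h3 : ∀ i ∈ Finset.univ, (hA.1.eigenvalues i ^ (1 / n : ℝ)) ^ n = hA.1.eigenvalues i :=
    fun i hi => by rw [one_div, Real.rpow_inv_natCast_pow (hz i hi) hn]
  rw [Finset.prod_congr rfl h3, ← Finset.mul_sum] at h2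
  have h4 : A.trace = ∑ i, hA.1.eigenvalues i := by
    simpa using hA.1.trace_eq_sum_eigenvalues
  have h5 : A.det = ∏ i, hA.1.eigenvalues i := by
    simpa using hA.1.det_eq_prod_eigenvalues
  rw [h4, h5]
  calc _ ≤ _ := h2
    _ = _ := by ring

lemma det_fderiv_gradient {u : Euc n → ℝ} {x : Euc n}
    (hu : DifferentiableAt ℝ (fderiv ℝ u) x) :
    (fderiv ℝ (gradient u) x).det = (Hess u x).det := by
  have h1 : LinearMap.toMatrix (EuclideanSpace.basisFun (Fin n) ℝ).toBasis
      (EuclideanSpace.basisFun (Fin n) ℝ).toBasis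
      (fderiv ℝ (gradient u) x : Euc n →ₗ[ℝ] Euc n) = (Hess u x)ᵀ := by
    ext i j
    rw [LinearMap.toMatrix_apply, Matrix.transpose_apply, hess_apply, ← inner_fderiv_gradient hu]
    simp [EuclideanSpace.inner_single_right]
  rw [← Matrix.det_transpose, ← h1, LinearMap.det_toMatrix]

/-- Since the gradient map has image `Ωt`, the mean curvature cannot be small everywhere. -/
lemma exists_le_minkDiv (hn : n ≠ 0) {Ω Ωt : Set (Euc n)} (hΩ : IsOpen Ω)
    (hb : Bornology.IsBounded Ω) (hbt : Bornology.IsBounded Ωt) (hΩt : IsOpen Ωt)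
    (hne : Ω.Nonempty) (hnet : Ωt.Nonempty) {u : Euc n → ℝ}
    (hu : ∀ x ∈ Ω, DifferentiableAt ℝ (fderiv ℝ u) x)
    (hpos : ∀ x ∈ Ω, (Hess u x).PosSemidef) (hgrad : ∀ x ∈ Ω, ‖gradient u x‖ < 1)
    (hinj : InjOn (gradient u) Ω) (himg : gradient u '' Ω = Ωt) :
    ∃ x ∈ Ω, 3 / 4 * (n * ((volume Ωt).toReal / (volume Ω).toReal) ^ ((1 : ℝ) / n)) ≤
      MinkDiv u x := by
  by_contra! hcon
  have hn' : (0 : ℝ) < n := by positivity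
  have hV : 0 < (volume Ω).toReal :=
    ENNReal.toReal_pos (hΩ.measure_pos volume hne).ne' hb.measure_lt_top.ne
  have hVt : 0 < (volume Ωt).toReal :=
    ENNReal.toReal_pos (hΩt.measure_pos volume hnet).ne' hbt.measure_lt_top.ne
  set q := ((volume Ωt).toReal / (volume Ω).toReal) ^ ((1 : ℝ) / n) with hq
  have hq0 : 0 < q := Real.rpow_pos_of_pos (div_pos hVt hV) _
  have hqn : q ^ n = (volume Ωt).toReal / (volume Ω).toReal := by
    rw [hq, one_div, Real.rpow_inv_natCast_pow (div_pos hVt hV).le hn]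
  have hdet : ∀ x ∈ Ω, |(fderiv ℝ (gradient u) x).det| ≤ (3 / 4 * q) ^ n := by
    intro x hx
    have hform : ∀ a, 0 ≤ fderiv ℝ (fderiv ℝ u) x a a := fun a => by
      have := (hpos x hx).dotProduct_mulVec_nonneg (fun i => a i)
      rw [← dotProduct_hess_mulVec]
      simpa using this
    rw [det_fderiv_gradient (hu x hx), abs_of_nonneg (hpos x hx).det_nonneg]
    refine ((hpos x hx).det_le_trace_div_pow hn).trans ?_
    have htr := trace_hess_le_minkDiv (hu x hx) (hgrad x hx) hform
    refine pow_le_pow_left₀ (div_nonneg (hpos x hx).trace_nonneg hn'.le) ?_ n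
    rw [div_le_iff₀ hn']
    linarith [hcon x hx]
  have hvol := lintegral_abs_det_fderiv_eq_addHaar_image volume hΩ.measurableSet
    (fun x hx => (hasFDerivAt_gradient (hu x hx)).differentiableAt.hasFDerivAt.hasFDerivWithinAt)
    hinj
  rw [himg] at hvol
  have hle : volume Ωt ≤ ENNReal.ofReal ((3 / 4 * q) ^ n) * volume Ω := by
    rw [← hvol, ← setLIntegral_const]
    exact setLIntegral_mono measurable_const fun x hx => ENNReal.ofReal_le_ofReal (hdet x hx)
  have hle2 := ENNReal.toReal_mono
    (ENNReal.mul_ne_top ENNReal.ofReal_ne_top hb.measure_lt_top.ne) hle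
  rw [ENNReal.toReal_mul, ENNReal.toReal_ofReal (by positivity), mul_pow, hqn, mul_assoc,
    div_mul_cancel₀ _ hV.ne'] at hle2
  have h34 : (3 / 4 : ℝ) ^ n < 1 := pow_lt_one₀ (by norm_num) (by norm_num) hn
  nlinarith

section InteriorEstimate

variable {E F : Type*} [NormedAddCommGroup E] [NormedSpace ℝ E]
  [NormedAddCommGroup F] [NormedSpace ℝ F]

lemma fderiv_fderiv_sum {ι : Type*} (s : Finset ι) {g : ι → E → F} {y : E}
    (hg : ∀ i, ContDiffAt ℝ 2 (g i) y) :
    fderiv ℝ (fderiv ℝ fun z => ∑ i ∈ s, g i z) y = ∑ i ∈ s, fderiv ℝ (fderiv ℝ (g i)) y := by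
  classical
  induction s using Finset.induction_on with
  | empty =>
    have : fderiv ℝ (fun _ : E => (0 : F)) = fun _ => 0 := by ext1 z; simp
    simp [this]
  | insert i s hi ih =>
    simp only [Finset.sum_insert hi]
    rw [fderiv_fderiv_add (hg i) (ContDiffAt.sum fun j _ => hg j), ih]

lemma fderiv_mul_norm_sq (M : ℝ) (y : Euc n) :
    fderiv ℝ (fun z : Euc n => M * ‖z‖ ^ 2) y = (2 * M) • innerSL ℝ y := by
  have h := ((hasStrictFDerivAt_norm_sq y).hasFDerivAt.const_mul M).fderiv
  rw [h]
  ext a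
  simp
  ring

lemma fderiv_fderiv_mul_norm_sq (M : ℝ) (y a : Euc n) :
    fderiv ℝ (fderiv ℝ fun z : Euc n => M * ‖z‖ ^ 2) y a a = 2 * M * ‖a‖ ^ 2 := by
  have h1 : (fderiv ℝ fun z : Euc n => M * ‖z‖ ^ 2) = fun z => ((2 * M) • innerSL ℝ) z := by
    ext1 z; rw [fderiv_mul_norm_sq]; rfl
  rw [h1, ContinuousLinearMap.fderiv]
  change (2 * M) * ⟪a, a⟫ = _
  rw [real_inner_self_eq_norm_sq]

/-- The differential inequality at an interior maximum of `ũ_ξξ + M |y|²`, where `ũ` solves a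
concave equation written as a supremum of linear expressions in `D²ũ`. -/
lemma interior_max_inequality {ι : Type*} [Fintype ι] {U : Set (Euc n)} (hU : IsOpen U)
    {ut : Euc n → ℝ} (hut : ContDiffOn ℝ (⊤ : ℕ∞) ut U) {r : ι → Euc n → Euc n}
    (hr : ∀ k, ContDiffOn ℝ (⊤ : ℕ∞) (r k) U) {f : Euc n × Euc n → ℝ} {c : ℝ}
    (hle : ∀ y ∈ U, ∀ q : ι → Euc n, ∑ k, (2 * ⟪q k, r k y⟫ -
      fderiv ℝ (fderiv ℝ ut) y (q k) (q k)) ≤ f (gradient ut y, y) + c)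
    {y₀ : Euc n} (hy₀ : y₀ ∈ U) {q : ι → Euc n}
    (heq : ∑ k, (2 * ⟪q k, r k y₀⟫ - fderiv ℝ (fderiv ℝ ut) y₀ (q k) (q k)) =
      f (gradient ut y₀, y₀) + c)
    {ξ : Euc n} {M : ℝ} (hM : 0 ≤ M)
    (hmax : IsLocalMax (fun y => fderiv ℝ (fderiv ℝ ut) y ξ ξ + M * ‖y‖ ^ 2) y₀)
    (hf : ContDiffAt ℝ 2 f (gradient ut y₀, y₀)) {ε K C : ℝ}
    (hfx : ∀ a, |fderiv ℝ f (gradient ut y₀, y₀) (a, 0)| ≤ ε * ‖a‖)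
    (hfxx : ∀ a, fderiv ℝ (fderiv ℝ f) (gradient ut y₀, y₀) (a, 0) (a, 0) ≤ 0)
    (hfxp : ∀ a, fderiv ℝ (fderiv ℝ f) (gradient ut y₀, y₀) (0, ξ) (a, 0) ≤ ε * ‖a‖)
    (hfpp : fderiv ℝ (fderiv ℝ f) (gradient ut y₀, y₀) (0, ξ) (0, ξ) ≤ K)
    (hC : ∀ k, ‖fderiv ℝ (fderiv ℝ (r k)) y₀ ξ ξ‖ ≤ C) :
    2 * M * ∑ k, ‖q k‖ ^ 2 ≤ 2 * (ε * ‖fderiv ℝ (gradient ut) y₀ ξ‖) + K +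
      2 * M * (ε * ‖y₀‖) + 2 * (C * ∑ k, ‖q k‖) := by
  have h2 : ∀ {G : Type} [NormedAddCommGroup G] [NormedSpace ℝ G] {k : Euc n → G},
      ContDiffOn ℝ (⊤ : ℕ∞) k U → ContDiffAt ℝ 2 k y₀ :=
    fun hk => (hk.contDiffAt (hU.mem_nhds hy₀)).of_le two_le_smooth
  have hD2 : ∀ a, ContDiffOn ℝ (⊤ : ℕ∞) (fun z => fderiv ℝ (fderiv ℝ ut) z a a) U := fun a =>
    ((((hut.fderiv_of_isOpen hU (m := (⊤ : ℕ∞)) (by norm_num)).fderiv_of_isOpen hU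
      (m := (⊤ : ℕ∞)) (by norm_num)).clm_apply contDiffOn_const).clm_apply contDiffOn_const)
  have hgrad : ContDiffOn ℝ (⊤ : ℕ∞) (gradient ut) U := contDiffOn_gradient hU hut
  have hsq : ContDiffAt ℝ 2 (fun z : Euc n => M * ‖z‖ ^ 2) y₀ :=
    contDiffAt_const.mul (contDiff_norm_sq ℝ).contDiffAt
  -- first-order condition
  have hfirst : ∀ b, fderiv ℝ (fun z => fderiv ℝ (fderiv ℝ ut) z ξ ξ) y₀ b =
      -(2 * M * ⟪y₀, b⟫) := by
    intro b
    have h := hmax.fderiv_eq_zero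
    rw [fderiv_fun_add ((h2 (hD2 ξ)).differentiableAt (by norm_num))
      (hsq.differentiableAt (by norm_num)), fderiv_mul_norm_sq] at h
    have := DFunLike.congr_fun h b
    simp at this
    linarith
  -- second-order condition
  have hsecond : ∀ b, fderiv ℝ (fderiv ℝ fun z => fderiv ℝ (fderiv ℝ ut) z ξ ξ) y₀ b b ≤
      -(2 * M * ‖b‖ ^ 2) := by
    intro b
    have h := hmax.fderiv_fderiv_nonpos ((h2 (hD2 ξ)).add hsq) b
    rw [fderiv_fderiv_add (h2 (hD2 ξ)) hsq] at h
    rw [_root_.add_apply, _root_.add_apply, fderiv_fderiv_mul_norm_sq] at h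
    linarith
  -- the curve of second derivatives of the gradient map
  have hgrad2 : fderiv ℝ (fderiv ℝ (gradient ut)) y₀ ξ ξ = -((2 * M) • y₀) := by
    refine ext_inner_left ℝ fun b => ?_
    have h1 := fderiv_fderiv_clm_comp (innerSL ℝ b) (h2 hgrad) ξ ξ
    have h3 : (fun z => innerSL ℝ b (gradient ut z)) = fun z => fderiv ℝ ut z b := by
      ext z; simp [inner_gradient_right]
    rw [h3, fderiv_fderiv_apply_comm hU hut hy₀, hfirst] at h1
    rw [innerSL_apply_apply] at h1
    rw [← h1, inner_neg_right, inner_smul_right, real_inner_comm]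
  -- the touching function
  set G : Euc n → Euc n × Euc n := fun z => (gradient ut z, z) with hG
  have hGc : ContDiffAt ℝ 2 G y₀ := (h2 hgrad).prodMk contDiffAt_id
  have hfG : ContDiffAt ℝ 2 (fun z => f (G z)) y₀ := ContDiffAt.comp y₀ (g := f) hf hGc
  have hlin : ∀ k, ContDiffAt ℝ 2 (fun z => ((-2 : ℝ) • innerSL ℝ (q k)) (r k z)) y₀ := fun k =>
    ((-2 : ℝ) • innerSL ℝ (q k)).contDiff.contDiffAt.comp y₀ (h2 (hr k))
  have hmk : ∀ k, ContDiffAt ℝ 2 (fun z => fderiv ℝ (fderiv ℝ ut) z (q k) (q k) +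
      ((-2 : ℝ) • innerSL ℝ (q k)) (r k z)) y₀ := fun k => (h2 (hD2 (q k))).add (hlin k)
  have hval : ∀ z, ∑ k, (fderiv ℝ (fderiv ℝ ut) z (q k) (q k) +
      ((-2 : ℝ) • innerSL ℝ (q k)) (r k z)) =
      -∑ k, (2 * ⟪q k, r k z⟫ - fderiv ℝ (fderiv ℝ ut) z (q k) (q k)) := fun z => by
    rw [← Finset.sum_neg_distrib]
    refine Finset.sum_congr rfl fun k _ => ?_
    simp
    ring
  have hmin : IsLocalMin (fun z => f (G z) + ∑ k, (fderiv ℝ (fderiv ℝ ut) z (q k) (q k) +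
      ((-2 : ℝ) • innerSL ℝ (q k)) (r k z))) y₀ := by
    filter_upwards [hU.mem_nhds hy₀] with z hz
    have h1 := hle z hz q
    rw [hval, hval, heq]
    simp only [hG]
    linarith
  have hpos := hmin.fderiv_fderiv_nonneg
    (hfG.add (ContDiffAt.sum fun k _ => hmk k)) ξ
  rw [fderiv_fderiv_add hfG (ContDiffAt.sum fun k _ => hmk k), fderiv_fderiv_sum _ hmk,
    _root_.add_apply, _root_.add_apply, fderiv_fderiv_comp (g := G) hf hGc, _root_.sum_apply,
    _root_.sum_apply] at hpos
  have hterm : ∀ k, fderiv ℝ (fderiv ℝ fun z => fderiv ℝ (fderiv ℝ ut) z (q k) (q k) +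
      ((-2 : ℝ) • innerSL ℝ (q k)) (r k z)) y₀ ξ ξ ≤
      -(2 * M * ‖q k‖ ^ 2) + 2 * (C * ‖q k‖) := by
    intro k
    rw [fderiv_fderiv_add (h2 (hD2 (q k))) (hlin k), _root_.add_apply, _root_.add_apply,
      fderiv_fderiv_fderiv_comm hU hut hy₀, fderiv_fderiv_clm_comp _ (h2 (hr k))]
    refine add_le_add (hsecond (q k)) ?_
    have h1 := (abs_le.1 (abs_real_inner_le_norm (q k) (fderiv ℝ (fderiv ℝ (r k)) y₀ ξ ξ))).1
    have h3 := mul_le_mul_of_nonneg_left (hC k) (norm_nonneg (q k))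
    simp
    nlinarith
  have hsum := Finset.sum_le_sum fun k (_ : k ∈ Finset.univ) => hterm k
  rw [Finset.sum_add_distrib, Finset.sum_neg_distrib, ← Finset.mul_sum, ← Finset.mul_sum,
    ← Finset.mul_sum] at hsum
  -- the derivatives of the inner map
  have hG1 : fderiv ℝ G y₀ ξ = (fderiv ℝ (gradient ut) y₀ ξ, ξ) := by
    have h1 := (((h2 hgrad).differentiableAt (by norm_num)).hasFDerivAt.prodMk
      (hasFDerivAt_id y₀)).fderiv
    change fderiv ℝ (fun z => (gradient ut z, id z)) y₀ ξ = _
    rw [h1]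
    simp
  have hG2 : fderiv ℝ (fderiv ℝ G) y₀ ξ ξ = (-((2 * M) • y₀), 0) := by
    refine Prod.ext ?_ ?_
    · have h1 := fderiv_fderiv_clm_comp (ContinuousLinearMap.fst ℝ (Euc n) (Euc n)) hGc ξ ξ
      rw [← hgrad2]
      exact h1.symm
    · have h1 := fderiv_fderiv_clm_comp (ContinuousLinearMap.snd ℝ (Euc n) (Euc n)) hGc ξ ξ
      have h3 : fderiv ℝ (fun z => ContinuousLinearMap.snd ℝ (Euc n) (Euc n) (G z)) =
          fun _ => ContinuousLinearMap.id ℝ (Euc n) := by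
        ext1 z
        exact fderiv_id
      rw [h3] at h1
      simpa using h1.symm
  set a := fderiv ℝ (gradient ut) y₀ ξ with ha
  have hsplit : ((a, ξ) : Euc n × Euc n) = (a, 0) + (0, ξ) := by simp
  have hsymm : fderiv ℝ (fderiv ℝ f) (G y₀) (a, 0) (0, ξ) =
      fderiv ℝ (fderiv ℝ f) (G y₀) (0, ξ) (a, 0) :=
    (hf.isSymmSndFDerivAt (by simp)).eq _ _
  have hb := hfx (-((2 * M) • y₀))
  rw [norm_neg, norm_smul, Real.norm_of_nonneg (by positivity)] at hb
  rw [hG1, hG2, hsplit] at hpos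
  simp only [map_add, _root_.add_apply] at hpos
  have k1 := hfxx a
  have k2 := hfxp a
  have k3 := (abs_le.1 hb).2
  have k4 : G y₀ = (gradient ut y₀, y₀) := rfl
  rw [k4] at hsymm hpos
  linarith

end InteriorEstimate

section Partial

variable {E F : Type*} [NormedAddCommGroup E] [NormedSpace ℝ E]
  [NormedAddCommGroup F] [NormedSpace ℝ F]

lemma fderiv_partial_fst {f : E × F → ℝ} {x : E} {p : F} (hf : DifferentiableAt ℝ f (x, p)) :
    fderiv ℝ (fun x' => f (x', p)) x =
      (fderiv ℝ f (x, p)).comp (ContinuousLinearMap.inl ℝ E F) :=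
  (hf.hasFDerivAt.comp x (hasFDerivAt_prodMk_left x p)).fderiv

lemma fderiv_fderiv_partial {f : E × F → ℝ} {x : E} {p : F} (hf : ContDiffAt ℝ 2 f (x, p))
    (b : F) (a : E) : fderiv ℝ (fun p' => fderiv ℝ (fun x' => f (x', p')) x) p b a =
      fderiv ℝ (fderiv ℝ f) (x, p) (0, b) (a, 0) := by
  have hcont : ContinuousAt (fun p' : F => (x, p')) p := by fun_prop
  have h1 : (fun p' => fderiv ℝ (fun x' => f (x', p')) x) =ᶠ[𝓝 p] fun p' =>
      (fderiv ℝ f (x, p')).comp (ContinuousLinearMap.inl ℝ E F) := by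
    filter_upwards [hcont.eventually (hf.eventually (by norm_num))] with p' h
    exact fderiv_partial_fst (h.differentiableAt (by norm_num))
  rw [h1.fderiv_eq]
  have hd : DifferentiableAt ℝ (fderiv ℝ f) (x, p) :=
    (hf.fderiv_right (m := 1) (by norm_num)).differentiableAt (by norm_num)
  have h2 : HasFDerivAt (fun p' => fderiv ℝ f (x, p'))
      ((fderiv ℝ (fderiv ℝ f) (x, p)).comp (ContinuousLinearMap.inr ℝ E F)) p :=
    hd.hasFDerivAt.comp p (hasFDerivAt_prodMk_right x p)
  rw [(h2.clm_comp (hasFDerivAt_const (ContinuousLinearMap.inl ℝ E F) p)).fderiv]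
  simp

/-- A function that is concave in its first variable has nonpositive second derivative in the
directions of that variable. -/
lemma fderiv_fderiv_fst_nonpos {f : E × F → ℝ} {x : E} {p : F} {s : Set E} (hs : s ∈ 𝓝 x)
    (hf : ContDiffAt ℝ 2 f (x, p)) (hconc : ConcaveOn ℝ s fun x' => f (x', p)) (a : E) :
    fderiv ℝ (fderiv ℝ f) (x, p) (a, 0) (a, 0) ≤ 0 := by
  have haff : ∀ L : E →L[ℝ] E × F, ContDiffAt ℝ 2 (fun z => (x, p) + L z) 0 ∧
      ContDiffAt ℝ 2 (fun z => f ((x, p) + L z)) 0 ∧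
      fderiv ℝ (fderiv ℝ fun z => f ((x, p) + L z)) 0 a a =
        fderiv ℝ (fderiv ℝ f) (x, p) (L a) (L a) := by
    intro L
    have h1 : ContDiffAt ℝ 2 (fun z => (x, p) + L z) 0 :=
      contDiffAt_const.add L.contDiff.contDiffAt
    have h2 : ContDiffAt ℝ 2 f ((x, p) + L 0) := by simpa using hf
    have h3 : fderiv ℝ (fun z => (x, p) + L z) = fun _ => L := by
      ext1 z
      rw [fderiv_const_add, ContinuousLinearMap.fderiv]
    refine ⟨h1, ContDiffAt.comp (g := f) 0 h2 h1, ?_⟩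
    rw [fderiv_fderiv_comp (g := fun z => (x, p) + L z) h2 h1, h3]
    simp
  obtain ⟨-, c1, d1⟩ := haff (ContinuousLinearMap.inl ℝ E F)
  obtain ⟨-, c2, d2⟩ := haff (-ContinuousLinearMap.inl ℝ E F)
  have hmax : IsLocalMax (fun z => f ((x, p) + ContinuousLinearMap.inl ℝ E F z) +
      f ((x, p) + (-ContinuousLinearMap.inl ℝ E F) z)) 0 := by
    have t1 : ContinuousAt (fun z : E => x + z) 0 := by fun_prop
    have t2 : ContinuousAt (fun z : E => x - z) 0 := by fun_prop
    have e1 : ∀ᶠ z in 𝓝 (0 : E), x + z ∈ s := t1.eventually (by simpa using hs)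
    have e2 : ∀ᶠ z in 𝓝 (0 : E), x - z ∈ s := t2.eventually (by simpa using hs)
    filter_upwards [e1, e2] with z h1 h2
    have h := hconc.2 h1 h2 (by norm_num : (0 : ℝ) ≤ 1 / 2) (by norm_num : (0 : ℝ) ≤ 1 / 2)
      (by norm_num)
    have hm : (1 / 2 : ℝ) • (x + z) + (1 / 2 : ℝ) • (x - z) = x := by
      rw [← smul_add, add_add_sub_cancel, ← two_smul ℝ x, smul_smul]
      norm_num
    rw [hm] at h
    simp only [smul_eq_mul] at h
    simp [← sub_eq_add_neg]
    linarith
  have h := hmax.fderiv_fderiv_nonpos (c1.add c2) a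
  rw [fderiv_fderiv_add c1 c2, _root_.add_apply, _root_.add_apply, d1, d2] at h
  simp only [_root_.neg_apply, map_neg, neg_neg, ContinuousLinearMap.inl_apply] at h
  linarith

end Partial

/-- The variational characterization of the inverse quadratic form. -/
lemma Matrix.PosDef.two_mul_dotProduct_sub_le {A : Matrix (Fin n) (Fin n) ℝ} (hA : A.PosDef)
    (q r : Fin n → ℝ) : 2 * (q ⬝ᵥ r) - q ⬝ᵥ (A⁻¹ *ᵥ q) ≤ r ⬝ᵥ (A *ᵥ r) := by
  have hdet : IsUnit A.det := (Matrix.isUnit_iff_isUnit_det A).1 hA.isUnit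
  have h := hA.inv.posSemidef.dotProduct_mulVec_nonneg (q - A *ᵥ r)
  have hinv : A⁻¹ *ᵥ (A *ᵥ r) = r := by
    rw [Matrix.mulVec_mulVec, Matrix.nonsing_inv_mul _ hdet, Matrix.one_mulVec]
  have hsymm : (A *ᵥ r) ⬝ᵥ (A⁻¹ *ᵥ q) = r ⬝ᵥ q := by
    have hT : Aᵀ = A := by simpa [Matrix.IsHermitian] using hA.1
    rw [← Matrix.vecMul_transpose, hT, ← Matrix.dotProduct_mulVec, Matrix.mulVec_mulVec,
      Matrix.mul_nonsing_inv _ hdet, Matrix.one_mulVec]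
  rw [Matrix.mulVec_sub, hinv] at h
  simp only [star_trivial, sub_dotProduct, dotProduct_sub] at h
  rw [hsymm] at h
  have e1 := dotProduct_comm r q
  have e2 := dotProduct_comm r (A *ᵥ r)
  linarith

/-- Uniform bounds on a compact subset of the unit ball for the vectors `frame k`. -/
lemma exists_frame_bounds {s : Set (Euc n)} (hs : IsCompact s)
    (hsub : s ⊆ Metric.ball (0 : Euc n) 1) : ∃ C R : ℝ, 0 ≤ C ∧ 0 < R ∧ ∀ y ∈ s,
      (∀ k, ∀ ξ : Euc n, ‖ξ‖ = 1 → ‖fderiv ℝ (fderiv ℝ (frame k)) y ξ ξ‖ ≤ C) ∧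
      ∑ k, ‖frame k y‖ ^ 2 ≤ R := by
  have hcont : ∀ k : Option (Fin n), ContinuousOn (fderiv ℝ (fderiv ℝ (frame k))) s := fun k =>
    (((contDiffOn_frame k).fderiv_of_isOpen Metric.isOpen_ball (m := 1) (by
      rw [one_add_one_eq_two]; exact two_le_smooth)).continuousOn_fderiv_of_isOpen
        Metric.isOpen_ball le_rfl).mono hsub
  have hnorm : ∀ k : Option (Fin n), ContinuousOn
      (fun y => ‖fderiv ℝ (fderiv ℝ (frame k)) y‖) s := fun k =>
    ContinuousOn.norm (f := fderiv ℝ (fderiv ℝ (frame k))) (hcont k)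
  choose c hc using fun k => hs.exists_bound_of_continuousOn (hnorm k)
  have hcont2 : ContinuousOn (fun y : Euc n => ∑ k, ‖frame k y‖ ^ 2) s :=
    continuousOn_finsetSum _ fun k _ => (((contDiffOn_frame k).continuousOn.mono hsub).norm).pow 2
  obtain ⟨R, hR⟩ := hs.exists_bound_of_continuousOn hcont2
  refine ⟨∑ k, |c k|, |R| + 1, Finset.sum_nonneg fun k _ => abs_nonneg _, by positivity, ?_⟩
  intro y hy
  refine ⟨fun k ξ hξ => ?_, ?_⟩
  · have h1 := (fderiv ℝ (fderiv ℝ (frame k)) y).le_opNorm₂ ξ ξ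
    rw [hξ, mul_one, mul_one] at h1
    calc _ ≤ _ := h1
      _ ≤ c k := (le_abs_self _).trans (hc k y hy)
      _ ≤ |c k| := le_abs_self _
      _ ≤ _ := Finset.single_le_sum (f := fun k => |c k|) (fun k _ => abs_nonneg _)
        (Finset.mem_univ k)
  · have h1 := (le_abs_self _).trans (hR y hy)
    linarith [le_abs_self R]

/-- A uniformly positive matrix is positive definite. -/
lemma MatLE.posDef {A : Matrix (Fin n) (Fin n) ℝ} {δ : ℝ} (hδ : 0 < δ)
    (h : MatLE (δ • (1 : Matrix (Fin n) (Fin n) ℝ)) A) : A.PosDef := by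
  have h1 : (δ • (1 : Matrix (Fin n) (Fin n) ℝ)).PosDef := Matrix.PosDef.one.smul hδ
  simpa using h1.add_posSemidef h

lemma fderiv_fderiv_nonneg_of_posDef {g : Euc n → ℝ} {x : Euc n} (h : (Hess g x).PosDef)
    (a : Euc n) : 0 ≤ fderiv ℝ (fderiv ℝ g) x a a := by
  rw [← dotProduct_hess_mulVec]
  simpa using h.posSemidef.dotProduct_mulVec_nonneg fun i => a i

lemma fderiv_fderiv_ne_zero_of_posDef (hn : n ≠ 0) {g : Euc n → ℝ} {x : Euc n}
    (h : (Hess g x).PosDef) : fderiv ℝ (fderiv ℝ g) x ≠ 0 := by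
  intro h0
  have h1 := h.diag_pos (i := ⟨0, Nat.pos_of_ne_zero hn⟩)
  simp [hess_apply, h0] at h1

lemma differentiableAt_fderiv_of_posDef (hn : n ≠ 0) {g : Euc n → ℝ} {x : Euc n}
    (h : (Hess g x).PosDef) : DifferentiableAt ℝ (fderiv ℝ g) x := by
  by_contra hnd
  exact fderiv_fderiv_ne_zero_of_posDef hn h (fderiv_zero_of_not_differentiableAt hnd)

lemma inner_eq_dotProduct_coords (a b : Euc n) : ⟪a, b⟫ = (fun i => a i) ⬝ᵥ fun i => b i := by
  simp [PiLp.inner_apply, dotProduct, mul_comm]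

/-- Fenchel inequality for the quadratic forms of inverse Hessians. -/
lemma two_mul_inner_sub_le {u ut : Euc n → ℝ} {x y : Euc n} (hpd : (Hess u x).PosDef)
    (hinv : Hess ut y = (Hess u x)⁻¹) (q r : Euc n) :
    2 * ⟪q, r⟫ - fderiv ℝ (fderiv ℝ ut) y q q ≤ fderiv ℝ (fderiv ℝ u) x r r := by
  rw [← dotProduct_hess_mulVec, ← dotProduct_hess_mulVec, hinv, inner_eq_dotProduct_coords]
  exact hpd.two_mul_dotProduct_sub_le _ _

/-- The vector at which `two_mul_inner_sub_le` is an equality. -/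
lemma exists_fenchel_eq {u ut : Euc n → ℝ} {x y : Euc n} (hpd : (Hess u x).PosDef)
    (hinv : Hess ut y = (Hess u x)⁻¹) (r : Euc n) :
    ∃ q : Euc n, ⟪q, r⟫ = fderiv ℝ (fderiv ℝ u) x r r ∧
      fderiv ℝ (fderiv ℝ ut) y q q = fderiv ℝ (fderiv ℝ u) x r r := by
  have hdet : IsUnit (Hess u x).det := (Matrix.isUnit_iff_isUnit_det _).1 hpd.isUnit
  have h1 : (Hess u x *ᵥ fun i => r i) ⬝ᵥ (fun i => r i) = fderiv ℝ (fderiv ℝ u) x r r := by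
    rw [← dotProduct_hess_mulVec, dotProduct_comm]
  refine ⟨WithLp.toLp 2 (Hess u x *ᵥ fun i => r i), ?_, ?_⟩
  · rw [inner_eq_dotProduct_coords]
    exact h1
  · rw [← dotProduct_hess_mulVec, hinv]
    change (Hess u x *ᵥ fun i => r i) ⬝ᵥ ((Hess u x)⁻¹ *ᵥ (Hess u x *ᵥ fun i => r i)) = _
    rw [Matrix.mulVec_mulVec, Matrix.nonsing_inv_mul _ hdet, Matrix.one_mulVec, h1]

/-- The quadratic form on unit vectors controls the norm of the derivative of the gradient. -/
lemma norm_fderiv_gradient_le {g : Euc n → ℝ} {y : Euc n} (hg : ContDiffAt ℝ 2 g y)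
    (hnonneg : ∀ a, 0 ≤ fderiv ℝ (fderiv ℝ g) y a a) {l : ℝ}
    (hl : ∀ a : Euc n, ‖a‖ = 1 → fderiv ℝ (fderiv ℝ g) y a a ≤ l) {ξ : Euc n} (hξ : ‖ξ‖ = 1) :
    ‖fderiv ℝ (gradient g) y ξ‖ ≤ l := by
  have hd : DifferentiableAt ℝ (fderiv ℝ g) y :=
    (hg.fderiv_right (m := 1) (by norm_num)).differentiableAt (by norm_num)
  set a := fderiv ℝ (gradient g) y ξ with ha
  rcases eq_or_ne a 0 with h0 | h0
  · rw [h0, norm_zero]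
    exact (hnonneg ξ).trans (hl ξ hξ)
  · set b : Euc n := ‖a‖⁻¹ • a with hb
    have hna : ‖a‖ ≠ 0 := norm_ne_zero_iff.2 h0
    have hb1 : ‖b‖ = 1 := by rw [hb, norm_smul, norm_inv, norm_norm, inv_mul_cancel₀ hna]
    have hab : fderiv ℝ (fderiv ℝ g) y ξ b = ‖a‖ := by
      rw [← inner_fderiv_gradient hd, ← ha, hb, real_inner_smul_right,
        real_inner_self_eq_norm_sq]
      field_simp
    have hsymm : fderiv ℝ (fderiv ℝ g) y b ξ = fderiv ℝ (fderiv ℝ g) y ξ b :=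
      (hg.isSymmSndFDerivAt (by simp)).eq b ξ
    have h1 := hnonneg (ξ - b)
    simp only [map_sub, _root_.sub_apply] at h1
    linarith [hl ξ hξ, hl b hb1]

/-- The information given by an interior maximum of `D²ũ(ξ,ξ) + M|y|²`. -/
lemma exists_interior_max_bound {Ω Ωt : Set (Euc n)} (hΩ : IsOpen Ω) (hΩt : IsOpen Ωt)
    (hball : Ωt ⊆ Metric.ball (0 : Euc n) 1) {f : Euc n × Euc n → ℝ} {ε K c : ℝ} (hε : 0 ≤ ε)
    (hfA : InA Ω Ωt f) (hfK : C2Bound Ω Ωt f K) (hfx : DxBound Ω Ωt f ε)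
    (hfxp : DxpBound Ω Ωt f ε) {u ut : Euc n → ℝ}
    (hu : ∀ x ∈ Ω, DifferentiableAt ℝ (fderiv ℝ u) x) (hpd : ∀ x ∈ Ω, (Hess u x).PosDef)
    (hpde : ∀ x ∈ Ω, MinkDiv u x = f (x, gradient u x) + c) (himg : gradient u '' Ω = Ωt)
    (hut : IsLegendre Ω Ωt u ut) {y₀ : Euc n} (hy₀ : y₀ ∈ Ωt) {ξ : Euc n} (hξ : ‖ξ‖ = 1)
    {M : ℝ} (hM : 0 ≤ M)
    (hmax : IsLocalMax (fun y => fderiv ℝ (fderiv ℝ ut) y ξ ξ + M * ‖y‖ ^ 2) y₀)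
    {l C R τ : ℝ} (hl : ∀ a : Euc n, ‖a‖ = 1 → fderiv ℝ (fderiv ℝ ut) y₀ a a ≤ l)
    (hC0 : 0 ≤ C) (hC : ∀ k, ‖fderiv ℝ (fderiv ℝ (frame k)) y₀ ξ ξ‖ ≤ C)
    (hR : ∑ k, ‖frame k y₀‖ ^ 2 ≤ R) (hτ : 0 ≤ τ) (hτf : τ ≤ f (gradient ut y₀, y₀) + c) :
    ∃ T : ℝ, τ ^ 2 ≤ R * T ∧
      2 * M * T ≤ 2 * (ε * l) + K + 2 * M * ε + C * ((n + 1) + T) := by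
  obtain ⟨hut1, -, hut3, hut4⟩ := hut
  have hutU : ContDiffOn ℝ (⊤ : ℕ∞) ut Ωt := hut1.mono subset_closure
  have hdual : ∀ y ∈ Ωt, gradient ut y ∈ Ω ∧ gradient u (gradient ut y) = y ∧
      Hess ut y = (Hess u (gradient ut y))⁻¹ := by
    intro y hy
    rw [← himg] at hy
    obtain ⟨x, hx, rfl⟩ := hy
    have hx' := hut3 x (subset_closure hx)
    rw [hx']
    exact ⟨hx, rfl, hut4 x (subset_closure hx)⟩
  have hsum : ∀ y ∈ Ωt, f (gradient ut y, y) + c =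
      ∑ k, fderiv ℝ (fderiv ℝ u) (gradient ut y) (frame k y) (frame k y) := by
    intro y hy
    obtain ⟨hx, hxy, -⟩ := hdual y hy
    have h1 := hpde _ hx
    have h2 : ‖gradient u (gradient ut y)‖ < 1 := by
      rw [hxy]
      simpa using hball hy
    rw [minkDiv_eq_sum_frame (hu _ hx) h2, hxy] at h1
    exact h1.symm
  obtain ⟨hx₀, hxy₀, hinv₀⟩ := hdual y₀ hy₀
  choose q hq1 hq2 using fun k => exists_fenchel_eq (hpd _ hx₀) hinv₀ (frame k y₀)
  have hnhds : closure Ω ×ˢ closure Ωt ∈ 𝓝 (gradient ut y₀, y₀) :=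
    prod_mem_nhds (Filter.mem_of_superset (hΩ.mem_nhds hx₀) subset_closure)
      (Filter.mem_of_superset (hΩt.mem_nhds hy₀) subset_closure)
  have hfc : ContDiffAt ℝ 2 f (gradient ut y₀, y₀) := hfA.1.contDiffAt hnhds
  have hxc : gradient ut y₀ ∈ closure Ω := subset_closure hx₀
  have hyc : y₀ ∈ closure Ωt := subset_closure hy₀
  have hξ0 : ‖((0 : Euc n), ξ)‖ = 1 := by simp [Prod.norm_def, hξ]
  have hut2 : ContDiffAt ℝ 2 ut y₀ :=
    (hutU.contDiffAt (hΩt.mem_nhds hy₀)).of_le two_le_smooth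
  have hpdt : (Hess ut y₀).PosDef := hinv₀ ▸ (hpd _ hx₀).inv
  have hfx' : ∀ a, |fderiv ℝ f (gradient ut y₀, y₀) (a, 0)| ≤ ε * ‖a‖ := by
    intro a
    have h1 := hfx _ hxc _ hyc
    rw [fderiv_partial_fst (hfc.differentiableAt (by norm_num))] at h1
    have h2 := ContinuousLinearMap.le_of_opNorm_le _ h1 a
    simpa using h2
  have hfxp' : ∀ a, fderiv ℝ (fderiv ℝ f) (gradient ut y₀, y₀) (0, ξ) (a, 0) ≤ ε * ‖a‖ := by
    intro a
    rw [← fderiv_fderiv_partial hfc]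
    have h1 := ContinuousLinearMap.le_of_opNorm_le _ (hfxp _ hxc _ hyc) ξ
    rw [hξ, mul_one] at h1
    exact (le_abs_self _).trans (ContinuousLinearMap.le_of_opNorm_le _ h1 a)
  have hfpp : fderiv ℝ (fderiv ℝ f) (gradient ut y₀, y₀) (0, ξ) (0, ξ) ≤ K := by
    have h1 := (iteratedFDeriv ℝ 2 f (gradient ut y₀, y₀)).le_opNorm ![(0, ξ), (0, ξ)]
    have h2 := (hfK.2 (gradient ut y₀, y₀) ⟨hxc, hyc⟩).2.2
    simp only [iteratedFDeriv_two_apply, Fin.prod_univ_two, Matrix.cons_val_zero,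
      Matrix.cons_val_one, hξ0, mul_one] at h1
    exact (le_abs_self _).trans (h1.trans h2)
  have heq : ∑ k, (2 * ⟪q k, frame k y₀⟫ - fderiv ℝ (fderiv ℝ ut) y₀ (q k) (q k)) =
      f (gradient ut y₀, y₀) + c := by
    rw [hsum y₀ hy₀]
    refine Finset.sum_congr rfl fun k _ => ?_
    rw [hq1, hq2]
    ring
  have key := interior_max_inequality hΩt hutU
    (fun k => (contDiffOn_frame k).mono hball) (f := f) (c := c)
    (fun y hy q => by
      obtain ⟨hx, -, hinv⟩ := hdual y hy
      rw [hsum y hy]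
      exact Finset.sum_le_sum fun k _ => two_mul_inner_sub_le (hpd _ hx) hinv _ _)
    hy₀ heq hM hmax hfc hfx'
    (fun a => fderiv_fderiv_fst_nonpos
      (Filter.mem_of_superset (hΩ.mem_nhds hx₀) subset_closure) hfc (hfA.2 _ hyc) a)
    hfxp' hfpp hC
  have hgrad := norm_fderiv_gradient_le hut2 (fderiv_fderiv_nonneg_of_posDef hpdt) hl hξ
  have hy1 : ‖y₀‖ ≤ 1 := (mem_ball_zero_iff.1 (hball hy₀)).le
  have hlin : 2 * ∑ k, ‖q k‖ ≤ (n + 1) + ∑ k, ‖q k‖ ^ 2 := by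
    have h1 : ∑ k : Option (Fin n), (1 : ℝ) = n + 1 := by simp
    rw [Finset.mul_sum, ← h1, ← Finset.sum_add_distrib]
    exact Finset.sum_le_sum fun k _ => by nlinarith [sq_nonneg (‖q k‖ - 1)]
  have hT0 : 0 ≤ ∑ k, ‖q k‖ ^ 2 := Finset.sum_nonneg fun k _ => sq_nonneg _
  refine ⟨∑ k, ‖q k‖ ^ 2, ?_, ?_⟩
  · have h1 : τ ≤ ∑ k, ‖frame k y₀‖ * ‖q k‖ := by
      refine hτf.trans ?_
      rw [hsum y₀ hy₀]
      refine Finset.sum_le_sum fun k _ => ?_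
      rw [← hq1, mul_comm]
      exact real_inner_le_norm _ _
    calc τ ^ 2 ≤ (∑ k, ‖frame k y₀‖ * ‖q k‖) ^ 2 := pow_le_pow_left₀ hτ h1 2
      _ ≤ (∑ k, ‖frame k y₀‖ ^ 2) * ∑ k, ‖q k‖ ^ 2 := Finset.sum_mul_sq_le_sq_mul_sq _ _ _
      _ ≤ _ := mul_le_mul_of_nonneg_right hR hT0
  · have h1 := mul_le_mul_of_nonneg_left hgrad hε
    have h2 : 2 * M * (ε * ‖y₀‖) ≤ 2 * M * ε := by
      have := mul_le_of_le_one_right hε hy1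
      gcongr
    have h3 := mul_le_mul_of_nonneg_left hlin hC0
    linarith

/-- On a compact set, a continuous field of quadratic forms attains its maximum over the unit
sphere. -/
lemma exists_max_quadratic (hn : n ≠ 0) {s : Set (Euc n)} (hs : IsCompact s) (hne : s.Nonempty)
    {B : Euc n → Euc n →L[ℝ] Euc n →L[ℝ] ℝ} (hB : ContinuousOn B s) :
    ∃ y₁ ∈ s, ∃ ξ : Euc n, ‖ξ‖ = 1 ∧ ∀ y ∈ s, ∀ a : Euc n, ‖a‖ = 1 → B y a a ≤ B y₁ ξ ξ := by
  have hsph : (Metric.sphere (0 : Euc n) 1).Nonempty :=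
    ⟨EuclideanSpace.single ⟨0, Nat.pos_of_ne_zero hn⟩ 1, by simp⟩
  have hcont : ContinuousOn (fun z : Euc n × Euc n => B z.1 z.2 z.2)
      (s ×ˢ Metric.sphere (0 : Euc n) 1) :=
    ((hB.comp continuousOn_fst fun z hz => hz.1).clm_apply continuousOn_snd).clm_apply
      continuousOn_snd
  obtain ⟨z, hz, hmax⟩ := (hs.prod (isCompact_sphere (0 : Euc n) 1)).exists_isMaxOn
    (hne.prod hsph) hcont
  exact ⟨z.1, hz.1, z.2, by simpa using hz.2, fun y hy a ha =>
    hmax (show (y, a) ∈ s ×ˢ Metric.sphere (0 : Euc n) 1 from ⟨hy, by simpa using ha⟩)⟩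

lemma quadSup_hess_le (hn : n ≠ 0) {g : Euc n → ℝ} {y : Euc n} {l : ℝ}
    (hl : ∀ a : Euc n, ‖a‖ = 1 → fderiv ℝ (fderiv ℝ g) y a a ≤ l) : quadSup (Hess g y) ≤ l := by
  have : Nonempty (Metric.sphere (0 : Euc n) 1) :=
    ⟨EuclideanSpace.single ⟨0, Nat.pos_of_ne_zero hn⟩ 1, by simp⟩
  refine ciSup_le fun ξ => ?_
  rw [dotProduct_hess_mulVec]
  exact hl ξ (by simp)

lemma le_quadSup_hess {g : Euc n → ℝ} {y : Euc n} {l : ℝ}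
    (hl : ∀ a : Euc n, ‖a‖ = 1 → fderiv ℝ (fderiv ℝ g) y a a ≤ l) {ξ : Euc n} (hξ : ‖ξ‖ = 1) :
    fderiv ℝ (fderiv ℝ g) y ξ ξ ≤ quadSup (Hess g y) := by
  rw [← dotProduct_hess_mulVec]
  refine le_ciSup (f := fun ξ : Metric.sphere (0 : Euc n) 1 =>
    (fun i => (ξ : Euc n) i) ⬝ᵥ (Hess g y).mulVec (fun i => (ξ : Euc n) i)) ⟨l, ?_⟩
    ⟨ξ, by simpa using hξ⟩
  rintro _ ⟨a, rfl⟩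
  simp only [dotProduct_hess_mulVec]
  exact hl a (by simp)

/-- The right-hand side of the equation is bounded below. -/
lemma le_rhs_of_oscCond (hn : n ≠ 0) {Ω Ωt : Set (Euc n)} (hΩ : IsOpen Ω)
    (hb : Bornology.IsBounded Ω) (hbt : Bornology.IsBounded Ωt) (hΩt : IsOpen Ωt)
    (hne : Ω.Nonempty) (hnet : Ωt.Nonempty) {u : Euc n → ℝ} {f : Euc n × Euc n → ℝ} {c : ℝ}
    (hosc : OSCcond Ω Ωt f) (hu : ∀ x ∈ Ω, DifferentiableAt ℝ (fderiv ℝ u) x)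
    (hpos : ∀ x ∈ Ω, (Hess u x).PosSemidef) (hgrad : ∀ x ∈ Ω, ‖gradient u x‖ < 1)
    (hinj : InjOn (gradient u) Ω) (himg : gradient u '' Ω = Ωt)
    (hpde : ∀ x ∈ Ω, MinkDiv u x = f (x, gradient u x) + c) {x p : Euc n} (hx : x ∈ closure Ω)
    (hp : p ∈ closure Ωt) :
    n * ((volume Ωt).toReal / (volume Ω).toReal) ^ ((1 : ℝ) / n) / 4 ≤ f (x, p) + c := by
  obtain ⟨z, hz, h⟩ := exists_le_minkDiv hn hΩ hb hbt hΩt hne hnet hu hpos hgrad hinj himg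
  rw [hpde z hz] at h
  have hzt : gradient u z ∈ Ωt := himg ▸ mem_image_of_mem _ hz
  have h1 := (le_abs_self _).trans (hosc z (subset_closure hz) x hx _ (subset_closure hzt) p hp)
  linarith

/-- At every point of the closed dual domain the Hessian of the Legendre transform is positive
definite. -/
lemma posDef_hess_legendre {Ω Ωt : Set (Euc n)} (hb : Bornology.IsBounded Ω) {u ut : Euc n → ℝ}
    (hu : ∀ x ∈ closure Ω, DifferentiableAt ℝ (fderiv ℝ u) x)
    (hpd : ∀ x ∈ closure Ω, (Hess u x).PosDef) (himg : gradient u '' Ω = Ωt)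
    (hut : IsLegendre Ω Ωt u ut) {y : Euc n} (hy : y ∈ closure Ωt) : (Hess ut y).PosDef := by
  have hcont : ContinuousOn (gradient u) (closure Ω) := fun x hx =>
    (hasFDerivAt_gradient (hu x hx)).continuousAt.continuousWithinAt
  have hclosed : IsClosed (gradient u '' closure Ω) :=
    (hb.isCompact_closure.image_of_continuousOn hcont).isClosed
  have hsub : closure Ωt ⊆ gradient u '' closure Ω :=
    closure_minimal (himg ▸ image_mono subset_closure) hclosed
  obtain ⟨x, hx, rfl⟩ := hsub hy
  rw [hut.2.2.2 x hx]
  exact (hpd x hx).inv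

/-- The choice of `M` is incompatible with an interior maximum. -/
lemma not_interior_max_bound {C R τ₀ τ ε K l N M T : ℝ} (hR : 0 < R) (hτ : 0 < τ)
    (hτR : τ₀ ^ 2 = R * τ) (hε : ε = τ / 4) (hK : 0 ≤ K) (hC : 0 ≤ C) (hN : 0 ≤ N) (hl : 0 ≤ l)
    (hM : M = 1 + C + (2 * (ε * l) + K + C * N) / τ) (hT : τ₀ ^ 2 ≤ R * T) :
    2 * (ε * l) + K + 2 * M * ε + C * (N + T) < 2 * M * T := by
  have hτT : τ ≤ T := le_of_mul_le_mul_left (hτR ▸ hT) hR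
  have hε0 : 0 < ε := by rw [hε]; positivity
  set A := 2 * (ε * l) + K + C * N with hA
  have hA0 : 0 ≤ A := by positivity
  have hM0 : 0 < M := by rw [hM]; positivity
  have h1 : A ≤ A / τ * T := by
    calc A = A / τ * τ := by field_simp
      _ ≤ _ := by gcongr
  have h2 : M * T = T + C * T + A / τ * T := by rw [hM]; ring
  have h3 : 2 * M * ε ≤ M * T := by
    rw [hε]
    nlinarith
  nlinarith

theorem statement_13 {n : ℕ} (hn : 2 ≤ n)
    (Ω Ωt : Set (Euc n)) (ht h : Euc n → ℝ) (θt θ : ℝ)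
    (hdom : DomainSetup Ω Ωt ht h θt θ)
    (hball : closure Ωt ⊆ Metric.ball (0 : Euc n) 1)
    :
    ∀ K : ℝ, 0 < K →
      ∃ ε C₂₀ : ℝ, 0 < ε ∧ 0 < C₂₀ ∧
        ∀ f : Euc n × Euc n → ℝ, InA Ω Ωt f → C2Bound Ω Ωt f K → OSCcond Ω Ωt f →
          DxBound Ω Ωt f ε → DxpBound Ω Ωt f ε →
        ∀ (c : ℝ) (u ut : Euc n → ℝ), IsSmoothSol Ω Ωt f c u → IsLegendre Ω Ωt u ut →
        ∀ y ∈ Ωt,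
          quadSup (Hess ut y) ≤
            2 * (⨆ y' : frontier Ωt, quadSup (Hess ut (y' : Euc n))) + C₂₀ := by
  intro K hK
  obtain ⟨hΩ, hΩt, hb, hbt, hne, hnet, -, hh, -, hΩth, -, -, -, hθ, -, hhess⟩ := hdom
  have hn0 : n ≠ 0 := by omega
  have hn' : (0 : ℝ) < n := by positivity
  obtain ⟨C, R, hC, hR, hCR⟩ := exists_frame_bounds hbt.isCompact_closure hball
  have hV : 0 < (volume Ω).toReal :=
    ENNReal.toReal_pos (hΩ.measure_pos volume hne).ne' hb.measure_lt_top.ne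
  have hVt : 0 < (volume Ωt).toReal :=
    ENNReal.toReal_pos (hΩt.measure_pos volume hnet).ne' hbt.measure_lt_top.ne
  set τ₀ := n * ((volume Ωt).toReal / (volume Ω).toReal) ^ ((1 : ℝ) / n) / 4 with hτ₀
  have hτ₀pos : 0 < τ₀ := by
    have := Real.rpow_pos_of_pos (div_pos hVt hV) ((1 : ℝ) / n)
    positivity
  set τ := τ₀ ^ 2 / R with hτ
  have hτpos : 0 < τ := by positivity
  refine ⟨τ / 4, 2 * (1 + C + (K + C * (n + 1)) / τ), by positivity, by positivity, ?_⟩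
  rintro f hfA hfK hosc hfx hfxp c u ut ⟨-, ⟨δ, hδ, hδu⟩, hgrad, hpde, himg⟩ hut y hy
  have hpd : ∀ x ∈ closure Ω, (Hess u x).PosDef := fun x hx => (hδu x hx).posDef hδ
  have hu : ∀ x ∈ closure Ω, DifferentiableAt ℝ (fderiv ℝ u) x := fun x hx =>
    differentiableAt_fderiv_of_posDef hn0 (hpd x hx)
  have hpdt : ∀ y ∈ closure Ωt, (Hess ut y).PosDef := fun y hy =>
    posDef_hess_legendre hb hu hpd himg hut hy
  have hconv : Convex ℝ Ωt := by
    rw [hΩth]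
    refine convex_pos_of_fderiv_fderiv_nonpos (hh.of_le two_le_smooth) fun y a => ?_
    have := (hhess y).fderiv_fderiv_le a
    nlinarith [sq_nonneg ‖a‖]
  have hcont : ContinuousOn (fderiv ℝ (fderiv ℝ ut)) (closure Ωt) :=
    continuousOn_fderiv_fderiv_closure hΩt hnet hconv hut.1 fun y hy =>
      fderiv_fderiv_ne_zero_of_posDef hn0 (hpdt y hy)
  obtain ⟨y₁, hy₁, ξ, hξ, hmax⟩ :=
    exists_max_quadratic hn0 hbt.isCompact_closure hnet.closure hcont
  set l := fderiv ℝ (fderiv ℝ ut) y₁ ξ ξ with hl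
  have hl0 : 0 ≤ l := fderiv_fderiv_nonneg_of_posDef (hpdt y₁ hy₁) ξ
  set M := 1 + C + (2 * (τ / 4 * l) + K + C * (n + 1)) / τ with hM
  have hM0 : 0 ≤ M := by positivity
  have hwcont : ContinuousOn (fun y => fderiv ℝ (fderiv ℝ ut) y ξ ξ + M * ‖y‖ ^ 2)
      (closure Ωt) :=
    ((hcont.clm_apply continuousOn_const).clm_apply continuousOn_const).add
      (continuous_const.mul (continuous_norm.pow 2)).continuousOn
  obtain ⟨y₀, hy₀, hwmax⟩ := hbt.isCompact_closure.exists_isMaxOn hnet.closure hwcont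
  have hy₀Ω : y₀ ∉ Ωt := by
    intro hy₀Ω
    have hinj : InjOn (gradient u) Ω := fun x hx z hz hxz => by
      rw [← hut.2.2.1 x (subset_closure hx), hxz, hut.2.2.1 z (subset_closure hz)]
    have hx₀ : gradient ut y₀ ∈ closure Ω := by
      rw [← himg] at hy₀Ω
      obtain ⟨x, hx, rfl⟩ := hy₀Ω
      rw [hut.2.2.1 x (subset_closure hx)]
      exact subset_closure hx
    have hrhs := le_rhs_of_oscCond hn0 hΩ hb hbt hΩt hne hnet hosc
      (fun x hx => hu x (subset_closure hx)) (fun x hx => (hpd x (subset_closure hx)).posSemidef)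
      (fun x hx => hgrad x (subset_closure hx)) hinj himg hpde hx₀ hy₀
    obtain ⟨T, hT, hbound⟩ := exists_interior_max_bound hΩ hΩt (subset_closure.trans hball)
      (by positivity) hfA hfK hfx hfxp (fun x hx => hu x (subset_closure hx))
      (fun x hx => hpd x (subset_closure hx)) hpde himg hut hy₀Ω hξ hM0
      (hwmax.isLocalMax (Filter.mem_of_superset (hΩt.mem_nhds hy₀Ω) subset_closure))
      (hmax y₀ hy₀) hC (fun k => (hCR y₀ hy₀).1 k ξ hξ) (hCR y₀ hy₀).2 hτ₀pos.le hrhs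
    exact hbound.not_gt (not_interior_max_bound hR hτpos (by rw [hτ]; field_simp) rfl hK.le hC
      (by positivity) hl0 hM hT)
  have hfr : y₀ ∈ frontier Ωt := by
    rw [frontier, hΩt.interior_eq]
    exact ⟨hy₀, hy₀Ω⟩
  have hB : fderiv ℝ (fderiv ℝ ut) y₀ ξ ξ ≤
      ⨆ y' : frontier Ωt, quadSup (Hess ut (y' : Euc n)) := by
    refine (le_quadSup_hess (hmax y₀ hy₀) hξ).trans ?_
    refine le_ciSup (f := fun y' : frontier Ωt => quadSup (Hess ut (y' : Euc n))) ⟨l, ?_⟩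
      ⟨y₀, hfr⟩
    rintro _ ⟨z, rfl⟩
    exact quadSup_hess_le hn0 (hmax z (frontier_subset_closure z.2))
  have hw : l + M * ‖y₁‖ ^ 2 ≤ fderiv ℝ (fderiv ℝ ut) y₀ ξ ξ + M * ‖y₀‖ ^ 2 := hwmax hy₁
  have hy₀1 : ‖y₀‖ ≤ 1 := (mem_ball_zero_iff.1 (hball hy₀)).le
  have h1 : M * ‖y₀‖ ^ 2 ≤ M := mul_le_of_le_one_right hM0 (pow_le_one₀ (norm_nonneg _) hy₀1)
  have h2 : 0 ≤ M * ‖y₁‖ ^ 2 := by positivity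
  have h3 : M = l / 2 + (1 + C + (K + C * (n + 1)) / τ) := by
    rw [hM]
    field_simp
    ring
  linarith [quadSup_hess_le hn0 (hmax y (subset_closure hy))]

end
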